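/- arXiv:2408.08635 — 9 statements merged into one kernel-verified Lean document; each statement's English description precedes it below -/
import Mathlib

section
/- Let X be a compact Hausdorff space and A a unital complex C*-algebra. Let Q be a closed *-subalgebra of C(X,A) containing C(X) (i.e., containing every function of the form x ↦ g(x)·1_A with g ∈ C(X,ℂ)). For each x ∈ X set Q_x := {f(x) : f ∈ Q} ⊆ A. Then Q = {f ∈ C(X,A) : f(x) ∈ Q_x for every x ∈ X}. -/
/- STATEMENT 0: For `X` compact Hausdorff, `A` a unital complex C*-algebra, and a
closed *-subalgebra `C(X) ⊆ Q ⊆ C(X,A)`, we have `Q = {f | ∀ x, f x ∈ Q_x}` where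
`Q_x = {q x | q ∈ Q}`. -/
theorem intermediate_algebra_eq_integral_of_fibres
    {X A : Type*} [TopologicalSpace X] [CompactSpace X] [T2Space X] [CStarAlgebra A]
    (Q : StarSubalgebra ℂ C(X, A)) (hQclosed : IsClosed (Q : Set C(X, A)))
    (hQX : ∀ g : C(X, ℂ),
      (⟨fun x => g x • (1 : A), g.continuous.smul continuous_const⟩ : C(X, A)) ∈ Q) :
    (Q : Set C(X, A)) = {f : C(X, A) | ∀ x : X, ∃ q ∈ Q, q x = f x} := by
  apply Set.Subset.antisymm
  · intro f hf x
    exact ⟨f, hf, rfl⟩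
  · intro f hf
    choose q hqQ hq using hf
    rw [← hQclosed.closure_eq, Metric.mem_closure_iff]
    intro ε hε
    have hε2 : 0 < ε / 2 := by positivity
    let U : X → Set X := fun x => {y | dist (q x y) (f y) < ε / 2}
    have hUo : ∀ x, IsOpen (U x) := fun x =>
      isOpen_lt ((q x).continuous.dist f.continuous) continuous_const
    have hxU : ∀ x, x ∈ U x := fun x => by
      simp only [U, Set.mem_setOf_eq, hq, dist_self]
      exact hε2
    obtain ⟨t, ht⟩ := isCompact_univ.elim_finite_subcover U hUo
      (fun x _ => Set.mem_iUnion.2 ⟨x, hxU x⟩)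
    obtain ⟨ρ, hρ⟩ := PartitionOfUnity.exists_isSubordinate (s := (Set.univ : Set X)) isClosed_univ
      (fun i : t => U i) (fun i => hUo i) (by
        intro y hy
        obtain ⟨x, hx⟩ := Set.mem_iUnion.1 (ht hy)
        obtain ⟨hxt, hxy⟩ := Set.mem_iUnion.1 hx
        exact Set.mem_iUnion.2 ⟨⟨x, hxt⟩, hxy⟩)
    let c : t → C(X, ℂ) := fun i => ⟨fun y => (ρ i y : ℂ), by fun_prop⟩
    let e : t → C(X, A) := fun i =>
      ⟨fun x => c i x • (1 : A), (c i).continuous.smul continuous_const⟩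
    refine ⟨∑ i : t, e i * q i, ?_, ?_⟩
    · exact sum_mem fun i _ => mul_mem (hQX (c i)) (hqQ i)
    · refine lt_of_le_of_lt ((ContinuousMap.dist_le hε2.le).2 fun y => ?_) (half_lt_self hε)
      have h := ρ.finsum_smul_mem_convex (g := fun i y => q i y) (t := Metric.ball (f y) (ε / 2))
        (Set.mem_univ y) (fun i hi => by
          exact hρ i (subset_tsupport _ hi)) (convex_ball _ _)
      rw [finsum_eq_sum_of_fintype] at h
      have h2 : (∑ i : t, e i * q i) y = ∑ i : t, ρ i y • q i y := by
        simp [ContinuousMap.sum_apply, e, c]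
      rw [h2, dist_comm]
      exact (Metric.mem_ball.1 h).le
end

section
/- Let G be a discrete group acting by *-automorphisms σ on a unital complex C*-algebra A, and assume A is G-simple. Let a ∈ A be a nonzero positive element with ‖a‖ = 1. Then there exist m ∈ ℕ, elements b₁,…,b_m ∈ A and group elements t₁,…,t_m ∈ G such that 1_A = Σ_{i=1}^m b_i σ_{t_i}(a) b_i* and moreover Σ_{i=1}^m b_i b_i* ≤ 2·1_A. -/
/-- Finite sums of conjugates of translates of `e`. -/
def ConjSum {G A : Type*} [Group G] [CStarAlgebra A] (σ : G →* (A →⋆ₐ[ℂ] A)) (e s : A) : Prop :=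
  ∃ (m : ℕ) (b : Fin m → A) (t : Fin m → G), (∑ i, b i * σ (t i) e * star (b i)) = s

theorem ConjSum.add {G A : Type*} [Group G] [CStarAlgebra A] {σ : G →* (A →⋆ₐ[ℂ] A)}
    {e s s' : A} (h : ConjSum σ e s) (h' : ConjSum σ e s') : ConjSum σ e (s + s') := by
  obtain ⟨m, b, t, rfl⟩ := h
  obtain ⟨n, c, u, rfl⟩ := h'
  exact ⟨m + n, Fin.append b c, Fin.append t u, by simp [Fin.sum_univ_add]⟩

theorem ConjSum.single {G A : Type*} [Group G] [CStarAlgebra A] (σ : G →* (A →⋆ₐ[ℂ] A))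
    (e d : A) (g : G) : ConjSum σ e (d * σ g e * star d) :=
  ⟨1, fun _ => d, fun _ => g, by simp⟩

theorem ConjSum.conj {G A : Type*} [Group G] [CStarAlgebra A] {σ : G →* (A →⋆ₐ[ℂ] A)}
    {e s : A} (h : ConjSum σ e s) (d : A) : ConjSum σ e (d * s * star d) := by
  obtain ⟨m, b, t, rfl⟩ := h
  exact ⟨m, fun i => d * b i, t, by simp [Finset.mul_sum, Finset.sum_mul, mul_assoc]⟩

theorem exists_conjSum_one
    {G A : Type*} [Group G] [CStarAlgebra A] [PartialOrder A] [StarOrderedRing A]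
    (σ : G →* (A →⋆ₐ[ℂ] A))
    (hGsimple : ∀ I : Set A, IsClosed I → (0 : A) ∈ I →
      (∀ a ∈ I, ∀ b ∈ I, a + b ∈ I) → (∀ a ∈ I, ∀ b : A, a * b ∈ I ∧ b * a ∈ I) →
      (∀ g : G, ∀ a ∈ I, σ g a ∈ I) → I = {0} ∨ I = Set.univ)
    (e : A) (he : 0 ≤ e) (he0 : e ≠ 0) : ConjSum σ e 1 := by
  let I₀ : AddSubmonoid A := AddSubmonoid.closure {z | ∃ x y g, z = x * σ g e * y}
  have hmulr : ∀ b : A, ∀ z ∈ I₀, z * b ∈ I₀ := by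
    intro b z hz
    induction hz using AddSubmonoid.closure_induction with
    | mem z hz =>
      obtain ⟨x, y, g, rfl⟩ := hz
      exact AddSubmonoid.subset_closure ⟨x, y * b, g, by simp only [mul_assoc]⟩
    | zero => simp
    | add x y _ _ hx hy => rw [add_mul]; exact add_mem hx hy
  have hmull : ∀ b : A, ∀ z ∈ I₀, b * z ∈ I₀ := by
    intro b z hz
    induction hz using AddSubmonoid.closure_induction with
    | mem z hz =>
      obtain ⟨x, y, g, rfl⟩ := hz
      exact AddSubmonoid.subset_closure ⟨b * x, y, g, by simp only [mul_assoc]⟩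
    | zero => simp
    | add x y _ _ hx hy => rw [mul_add]; exact add_mem hx hy
  have hσ : ∀ h : G, ∀ z ∈ I₀, σ h z ∈ I₀ := by
    intro h z hz
    induction hz using AddSubmonoid.closure_induction with
    | mem z hz =>
      obtain ⟨x, y, g, rfl⟩ := hz
      exact AddSubmonoid.subset_closure ⟨σ h x, σ h y, h * g, by
        rw [map_mul, map_mul, map_mul σ]; rfl⟩
    | zero => simp
    | add x y _ _ hx hy => rw [map_add]; exact add_mem hx hy
  have hbound : ∀ z ∈ I₀, ∃ s, ConjSum σ e s ∧ z + star z ≤ s := by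
    intro z hz
    induction hz using AddSubmonoid.closure_induction with
    | mem z hz =>
      obtain ⟨x, y, g, rfl⟩ := hz
      refine ⟨_, (ConjSum.single σ e x g).add (ConjSum.single σ e (star y) g), ?_⟩
      have h1 : 0 ≤ σ g e := map_nonneg (σ g) he
      have h2 := star_right_conjugate_nonneg h1 (x - star y)
      have h3 : star (σ g e) = σ g e := (IsSelfAdjoint.of_nonneg h1).star_eq
      rw [← sub_nonneg]
      convert h2 using 1
      simp only [star_mul, star_sub, star_star, h3]
      noncomm_ring
    | zero => exact ⟨0, ⟨0, Fin.elim0, Fin.elim0, by simp⟩, by simp⟩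
    | add x y _ _ hx hy =>
      obtain ⟨s, hs, h1⟩ := hx
      obtain ⟨s', hs', h2⟩ := hy
      refine ⟨_, hs.add hs', ?_⟩
      rw [star_add, add_add_add_comm]
      exact add_le_add h1 h2
  have heI : e ∈ I₀ := AddSubmonoid.subset_closure ⟨1, 1, 1, by simp; rfl⟩
  have huniv : closure (I₀ : Set A) = Set.univ := by
    refine (hGsimple (closure (I₀ : Set A)) isClosed_closure (subset_closure I₀.zero_mem)
      ?_ ?_ ?_).resolve_left ?_
    · intro a ha b hb
      exact I₀.topologicalClosure.add_mem ha hb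
    · intro a ha b
      exact ⟨map_mem_closure (f := fun z : A => z * b) (by fun_prop) ha (hmulr b),
        map_mem_closure (f := fun z : A => b * z) (by fun_prop) ha (hmull b)⟩
    · intro g a ha
      exact map_mem_closure (map_continuous (σ g)) ha (hσ g)
    · intro h
      exact he0 (by simpa [h] using subset_closure (s := (I₀ : Set A)) heI)
  have h1 : (1 : A) ∈ I₀ := by
    have h1c : (1 : A) ∈ closure (I₀ : Set A) := by rw [huniv]; trivial
    obtain ⟨x, hx, hd⟩ := Metric.mem_closure_iff.1 h1c 1 one_pos
    rw [dist_eq_norm] at hd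
    have hu : IsUnit x := by
      have := isUnit_one_sub_of_norm_lt_one hd
      simpa using this
    obtain ⟨u, rfl⟩ := hu
    simpa using hmull (↑u⁻¹) _ hx
  obtain ⟨s, hs, hle⟩ := hbound 1 h1
  have h1s : (1 : A) ≤ s := by
    refine le_trans ?_ hle
    rw [star_one]
    exact le_add_of_nonneg_right zero_le_one
  have hs0 : 0 ≤ s := zero_le_one.trans h1s
  have hsu : IsUnit s := CStarAlgebra.isUnit_of_le 1 h1s
  have hr := hs.conj (s ^ (-(1/2) : ℝ))
  have hsa : star (s ^ (-(1/2) : ℝ)) = s ^ (-(1/2) : ℝ) :=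
    (IsSelfAdjoint.of_nonneg CFC.rpow_nonneg).star_eq
  have hone : s ^ (-(1/2) : ℝ) * s * s ^ (-(1/2) : ℝ) = 1 := by
    nth_rewrite 2 [← CFC.rpow_one s]
    rw [← CFC.rpow_add hsu, ← CFC.rpow_add hsu]
    norm_num
    exact CFC.rpow_zero s
  rwa [hsa, hone] at hr

/- STATEMENT 4: In a `G`-simple unital C*-algebra `A` (action `σ` by *-automorphisms),
every nonzero positive element `a` of norm one admits elements `b₁,…,b_m ∈ A` and
`t₁,…,t_m ∈ G` with `1 = Σ bᵢ σ_{tᵢ}(a) bᵢ*` and `Σ bᵢ bᵢ* ≤ 2`. -/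
theorem one_eq_sum_conjugates_of_GSimple
    {G A : Type*} [Group G] [CStarAlgebra A] [PartialOrder A] [StarOrderedRing A]
    (σ : G →* (A →⋆ₐ[ℂ] A))
    (hGsimple : ∀ I : Set A, IsClosed I → (0 : A) ∈ I →
      (∀ a ∈ I, ∀ b ∈ I, a + b ∈ I) → (∀ a ∈ I, ∀ b : A, a * b ∈ I ∧ b * a ∈ I) →
      (∀ g : G, ∀ a ∈ I, σ g a ∈ I) → I = {0} ∨ I = Set.univ)
    (a : A) (ha_pos : 0 ≤ a) (ha_ne : a ≠ 0) (ha_norm : ‖a‖ = 1) :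
    ∃ (m : ℕ) (b : Fin m → A) (t : Fin m → G),
      (∑ i, b i * σ (t i) a * star (b i)) = 1 ∧
      (∑ i, b i * star (b i)) ≤ 2 := by
  have hasa : IsSelfAdjoint a := .of_nonneg ha_pos
  set c : A := a - algebraMap ℝ A (1/2) with hc
  have hcsa : IsSelfAdjoint c := hasa.sub (.algebraMap A (.all _))
  set p : A := c⁺ with hp
  have hp0 : 0 ≤ p := CFC.posPart_nonneg c
  have hpsa : star p = p := (IsSelfAdjoint.of_nonneg hp0).star_eq
  have hcp : c = p - c⁻ := (CFC.posPart_sub_negPart c hcsa).symm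
  have hpn : p * c⁻ = 0 := CFC.posPart_mul_negPart c
  have hpcp : p * c * p = p * p * p := by
    rw [hcp, mul_sub, hpn, sub_zero]
  have hppp : 0 ≤ p * p * p := by
    simpa [hpsa] using star_right_conjugate_nonneg hp0 p
  have hpa : p * a * p - (1/2 : ℝ) • (p * p) = p * p * p := by
    rw [← hpcp, hc, Algebra.algebraMap_eq_smul_one]
    simp [mul_sub, sub_mul]
  have hle : p * p ≤ (2 : ℝ) • (p * a * p) := by
    have : (2 : ℝ) • (p * a * p) - p * p = (2 : ℝ) • (p * p * p) := by
      rw [← hpa, smul_sub, smul_smul]; norm_num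
    rw [← sub_nonneg, this]
    exact smul_nonneg (by norm_num) hppp
  have he : 0 ≤ p * a * p := by
    simpa [hpsa] using star_right_conjugate_nonneg ha_pos p
  have he0 : p * a * p ≠ 0 := by
    intro h
    rw [h, smul_zero] at hle
    have hpp0 : 0 ≤ p * p := by simpa [hpsa] using mul_star_self_nonneg p
    have hpp : p * star p = 0 := by rw [hpsa]; exact le_antisymm hle hpp0
    have hpz : p = 0 := by simpa using hpp
    have hca : c ≤ 0 := by
      rw [hcp, hpz, zero_sub, neg_nonpos]
      exact CFC.negPart_nonneg c
    have : a ≤ algebraMap ℝ A (1/2) := by rwa [hc, sub_nonpos] at hca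
    have := (CStarAlgebra.norm_le_iff_le_algebraMap a (by norm_num : (0:ℝ) ≤ 1/2) ha_pos).2 this
    rw [ha_norm] at this
    norm_num at this
  obtain ⟨m, d, t, hsum⟩ := exists_conjSum_one σ hGsimple _ he he0
  refine ⟨m, fun i => d i * σ (t i) p, t, ?_, ?_⟩
  · rw [← hsum]
    refine Finset.sum_congr rfl fun i _ => ?_
    rw [star_mul, ← map_star, hpsa, map_mul, map_mul]
    simp only [mul_assoc]
  · have h2 : (2 : A) = ∑ i, d i * σ (t i) ((2 : ℝ) • (p * a * p)) * star (d i) := by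
      have : (2 : ℝ) • (p * a * p) = p * a * p + p * a * p := two_smul _ _
      simp only [this, map_add, mul_add, add_mul, Finset.sum_add_distrib]
      simp only [map_add, map_mul] at hsum ⊢
      rw [hsum]; norm_num
    rw [h2]
    refine Finset.sum_le_sum fun i _ => ?_
    have h3 : σ (t i) (p * p) ≤ σ (t i) ((2 : ℝ) • (p * a * p)) := by
      rw [← sub_nonneg, ← map_sub]
      exact map_nonneg _ (sub_nonneg.2 hle)
    have h4 := star_right_conjugate_le_conjugate h3 (d i)
    refine le_trans (le_of_eq ?_) h4
    rw [star_mul, ← map_star, hpsa, map_mul]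
    simp only [mul_assoc]
end

section
/- Let G be a discrete group acting by *-automorphisms σ on a unital complex C*-algebra A, and assume A is G-simple. Let φ be a state on A. Then for every ε > 0 and every finite subset F ⊆ A there exist m ∈ ℕ, elements b₁,…,b_m ∈ A and t₁,…,t_m ∈ G such that Σ_{j=1}^m b_j b_j* = 1_A (so the map x ↦ Σ_j b_j σ_{t_j}(x) b_j* is unital completely positive) and ‖Σ_{j=1}^m b_j σ_{t_j}(a) b_j* − φ(a)·1_A‖ ≤ ε for every a ∈ F. -/
open scoped ComplexOrder

namespace ElemUCP

section
variable {G A : Type*} [Group G] [CStarAlgebra A]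

/-- the elementary map `x ↦ b σ_t(x) b*`. -/
noncomputable def sandwich (σ : G →* (A →⋆ₐ[ℂ] A)) (b : A) (t : G) : A →ₗ[ℂ] A where
  toFun x := b * σ t x * star b
  map_add' x y := by simp [mul_add, add_mul]
  map_smul' c x := by simp

lemma sandwich_apply (σ : G →* (A →⋆ₐ[ℂ] A)) (b : A) (t : G) (x : A) :
    sandwich σ b t x = b * σ t x * star b := rfl

/-- finite sums of elementary maps. -/
noncomputable def elems (σ : G →* (A →⋆ₐ[ℂ] A)) : AddSubmonoid (A →ₗ[ℂ] A) :=
  AddSubmonoid.closure {T | ∃ b t, T = sandwich σ b t}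

lemma elems_repr (σ : G →* (A →⋆ₐ[ℂ] A)) {T : A →ₗ[ℂ] A} (hT : T ∈ elems σ) :
    ∃ (m : ℕ) (b : Fin m → A) (t : Fin m → G),
      ∀ x, T x = ∑ j, b j * σ (t j) x * star (b j) := by
  induction hT using AddSubmonoid.closure_induction with
  | mem T h =>
    obtain ⟨b, t, rfl⟩ := h
    exact ⟨1, fun _ => b, fun _ => t, fun x => by simp [sandwich_apply]⟩
  | zero => exact ⟨0, Fin.elim0, Fin.elim0, fun x => by simp⟩
  | add T S _ _ hT hS =>
    obtain ⟨m, b, t, h⟩ := hT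
    obtain ⟨n, c, s, h'⟩ := hS
    refine ⟨m + n, Fin.append b c, Fin.append t s, fun x => ?_⟩
    rw [Fin.sum_univ_add]
    simp [h, h']

lemma elems_conj (σ : G →* (A →⋆ₐ[ℂ] A)) {T : A →ₗ[ℂ] A} (hT : T ∈ elems σ) (c : A) :
    ∃ S ∈ elems σ, ∀ x, S x = c * T x * star c := by
  induction hT using AddSubmonoid.closure_induction with
  | mem T h =>
    obtain ⟨b, t, rfl⟩ := h
    exact ⟨sandwich σ (c * b) t, AddSubmonoid.subset_closure ⟨_, _, rfl⟩,
      fun x => by simp [sandwich_apply, mul_assoc]⟩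
  | zero => exact ⟨0, zero_mem _, fun x => by simp⟩
  | add T S _ _ hT hS =>
    obtain ⟨T', h1, h2⟩ := hT
    obtain ⟨S', h3, h4⟩ := hS
    exact ⟨T' + S', add_mem h1 h3, fun x => by simp [h2, h4, mul_add, add_mul]⟩

lemma elems_comp (σ : G →* (A →⋆ₐ[ℂ] A)) {T : A →ₗ[ℂ] A} (hT : T ∈ elems σ) (c : A) :
    ∃ S ∈ elems σ, ∀ x, S x = T (c * x * star c) := by
  induction hT using AddSubmonoid.closure_induction with
  | mem T h =>
    obtain ⟨b, t, rfl⟩ := h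
    exact ⟨sandwich σ (b * σ t c) t, AddSubmonoid.subset_closure ⟨_, _, rfl⟩,
      fun x => by simp [sandwich_apply, mul_assoc, map_star]⟩
  | zero => exact ⟨0, zero_mem _, fun x => by simp⟩
  | add T S _ _ hT hS =>
    obtain ⟨T', h1, h2⟩ := hT
    obtain ⟨S', h3, h4⟩ := hS
    exact ⟨T' + S', add_mem h1 h3, fun x => by simp [h2, h4]⟩

lemma elems_smul (σ : G →* (A →⋆ₐ[ℂ] A)) {T : A →ₗ[ℂ] A} (hT : T ∈ elems σ) {r : ℝ}
    (hr : 0 ≤ r) : ∃ S ∈ elems σ, ∀ x, S x = r • T x := by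
  obtain ⟨S, h1, h2⟩ := elems_conj σ hT ((Real.sqrt r) • (1 : A))
  refine ⟨S, h1, fun x => ?_⟩
  rw [h2]
  simp [smul_smul, Real.mul_self_sqrt hr]

variable [PartialOrder A] [StarOrderedRing A]

lemma elems_nonneg (σ : G →* (A →⋆ₐ[ℂ] A)) {T : A →ₗ[ℂ] A} (hT : T ∈ elems σ) {x : A}
    (hx : 0 ≤ x) : 0 ≤ T x := by
  induction hT using AddSubmonoid.closure_induction with
  | mem T h =>
    obtain ⟨b, t, rfl⟩ := h
    rw [sandwich_apply]
    exact star_right_conjugate_nonneg (map_nonneg _ hx) _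
  | zero => simp
  | add T S _ _ hT hS => exact add_nonneg hT hS

lemma full_aux (σ : G →* (A →⋆ₐ[ℂ] A)) {k : A} (hk : 0 ≤ k) {z : A}
    (hz : z ∈ AddSubmonoid.closure {z : A | ∃ x t y, z = x * σ t k * y}) :
    ∃ T ∈ elems σ, z + star z ≤ T k := by
  induction hz using AddSubmonoid.closure_induction with
  | mem z h =>
    obtain ⟨x, t, y, rfl⟩ := h
    refine ⟨sandwich σ x t + sandwich σ (star y) t,
      add_mem (AddSubmonoid.subset_closure ⟨_, _, rfl⟩)
        (AddSubmonoid.subset_closure ⟨_, _, rfl⟩), ?_⟩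
    have hk' : 0 ≤ σ t k := map_nonneg _ hk
    have hs : star (σ t k) = σ t k := (IsSelfAdjoint.of_nonneg hk').star_eq
    have := star_right_conjugate_nonneg hk' (x - star y)
    rw [← sub_nonneg]
    convert this using 1
    simp only [LinearMap.add_apply, sandwich_apply, star_sub, star_mul, star_star, hs]
    noncomm_ring
  | zero => exact ⟨0, zero_mem _, by simp⟩
  | add z w _ _ hT hS =>
    obtain ⟨T', h1, h2⟩ := hT
    obtain ⟨S', h3, h4⟩ := hS
    refine ⟨T' + S', add_mem h1 h3, ?_⟩
    calc z + w + star (z + w) = (z + star z) + (w + star w) := by rw [star_add]; abel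
      _ ≤ _ := add_le_add h2 h4

lemma full (σ : G →* (A →⋆ₐ[ℂ] A))
    (hGsimple : ∀ I : Set A, IsClosed I → (0 : A) ∈ I →
      (∀ a ∈ I, ∀ b ∈ I, a + b ∈ I) → (∀ a ∈ I, ∀ b : A, a * b ∈ I ∧ b * a ∈ I) →
      (∀ g : G, ∀ a ∈ I, σ g a ∈ I) → I = {0} ∨ I = Set.univ)
    {k : A} (hk : 0 ≤ k) (hk0 : k ≠ 0) : ∃ T ∈ elems σ, T k = 1 := by
  set J := AddSubmonoid.closure {z : A | ∃ x t y, z = x * σ t k * y} with hJ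
  have hkJ : k ∈ J := AddSubmonoid.subset_closure ⟨1, 1, 1, by rw [map_one]; simp; rfl⟩
  have hr : ∀ b, ∀ a ∈ J, a * b ∈ J := by
    intro b a ha
    induction ha using AddSubmonoid.closure_induction with
    | mem z h =>
      obtain ⟨x, t, y, rfl⟩ := h
      exact AddSubmonoid.subset_closure ⟨x, t, y * b, by simp [mul_assoc]⟩
    | zero => simp
    | add z w _ _ h1 h2 => rw [add_mul]; exact add_mem h1 h2
  have hl : ∀ b, ∀ a ∈ J, b * a ∈ J := by
    intro b a ha
    induction ha using AddSubmonoid.closure_induction with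
    | mem z h =>
      obtain ⟨x, t, y, rfl⟩ := h
      exact AddSubmonoid.subset_closure ⟨b * x, t, y, by simp [mul_assoc]⟩
    | zero => simp
    | add z w _ _ h1 h2 => rw [mul_add]; exact add_mem h1 h2
  have hg : ∀ g, ∀ a ∈ J, σ g a ∈ J := by
    intro g a ha
    induction ha using AddSubmonoid.closure_induction with
    | mem z h =>
      obtain ⟨x, t, y, rfl⟩ := h
      exact AddSubmonoid.subset_closure ⟨σ g x, g * t, σ g y, by rw [map_mul σ]; simp; rfl⟩
    | zero => simp
    | add z w _ _ h1 h2 => rw [map_add]; exact add_mem h1 h2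
  have hσc : ∀ g, Continuous (σ g) := fun g => map_continuous (σ g)
  have key := hGsimple (closure (J : Set A)) isClosed_closure
    (subset_closure (zero_mem J)) (fun a ha b hb => J.topologicalClosure.add_mem ha hb)
    (fun a ha b => ⟨map_mem_closure (f := fun a => a * b) (by fun_prop) ha (fun a ha => hr b a ha),
      map_mem_closure (f := fun a => b * a) (by fun_prop) ha (fun a ha => hl b a ha)⟩)
    (fun g a ha => map_mem_closure (hσc g) ha (fun a ha => hg g a ha))
  rcases key with h | h
  · exact absurd (h ▸ subset_closure hkJ : k ∈ ({0} : Set A)) hk0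
  have h1 : (1 : A) ∈ closure (J : Set A) := h ▸ Set.mem_univ _
  rw [Metric.mem_closure_iff] at h1
  obtain ⟨z, hz, hd⟩ := h1 (1/2) (by norm_num)
  obtain ⟨T, hT, hTk⟩ := full_aux σ hk hz
  rw [dist_eq_norm] at hd
  have hsa : IsSelfAdjoint ((1 - z) + star (1 - z)) := IsSelfAdjoint.add_star_self _
  have hle := hsa.le_algebraMap_norm_self
  have hn : ‖(1 - z) + star (1 - z)‖ ≤ 1 := by
    refine (norm_add_le _ _).trans ?_
    rw [norm_star]; linarith
  have hle1 : (1 - z) + star (1 - z) ≤ 1 := by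
    refine hle.trans ?_
    simpa using algebraMap_mono A hn
  have hT1 : 1 ≤ T k := by
    refine le_trans ?_ hTk
    rw [← sub_nonneg] at hle1 ⊢
    convert hle1 using 1
    simp only [star_sub, star_one]; abel
  have hsp : IsStrictlyPositive (T k) := (isStrictlyPositive_one (A := A)).of_le hT1
  obtain ⟨S, hS, hS'⟩ := elems_conj σ hT ((T k) ^ (-(1 / 2) : ℝ))
  refine ⟨S, hS, ?_⟩
  rw [hS', (IsSelfAdjoint.of_nonneg CFC.rpow_nonneg).star_eq]
  exact CFC.conjugate_rpow_neg_one_half _ hsp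


lemma norm_le_of_bounds {y : A} {r : ℝ} (hr : 0 ≤ r) (hy : IsSelfAdjoint y)
    (h1 : y ≤ r • (1 : A)) (h2 : -(r • (1 : A)) ≤ y) : ‖y‖ ≤ r := by
  rcases subsingleton_or_nontrivial A with hA | hA
  · rw [Subsingleton.elim y 0]; simpa using hr
  rw [← Algebra.algebraMap_eq_smul_one] at h1 h2
  rw [← map_neg] at h2
  rw [le_algebraMap_iff_spectrum_le hy] at h1
  rw [algebraMap_le_iff_le_spectrum hy] at h2
  rcases CStarAlgebra.norm_or_neg_norm_mem_spectrum hy with h | h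
  · exact h1 _ h
  · linarith [h2 _ h]

/-- real states -/
def IsSt (g : A →ₗ[ℝ] ℝ) : Prop := g 1 = 1 ∧ ∀ y, 0 ≤ y → 0 ≤ g y

lemma pos_abs_le {g : A →ₗ[ℝ] ℝ} (hg : ∀ y, 0 ≤ y → 0 ≤ g y) {y : A} (hy : IsSelfAdjoint y) :
    |g y| ≤ ‖y‖ * g 1 := by
  have h1 := hy.le_algebraMap_norm_self
  have h2 := hy.neg_algebraMap_norm_le_self
  rw [Algebra.algebraMap_eq_smul_one] at h1 h2
  have h1 := hg _ (sub_nonneg.2 h1)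
  have h2 := hg _ (sub_nonneg.2 h2)
  simp at h1 h2
  rw [abs_le]; constructor <;> linarith

lemma nonneg_of_states {y : A} (hy : IsSelfAdjoint y)
    (h : ∀ g : A →ₗ[ℝ] ℝ, IsSt g → 0 ≤ g y) : 0 ≤ y := by
  by_contra hcon
  have hconv : Convex ℝ {a : A | 0 ≤ a} := by
    intro a ha b hb s t hs ht _
    exact add_nonneg (smul_nonneg hs ha) (smul_nonneg ht hb)
  obtain ⟨f, u, hfu, hfb⟩ := geometric_hahn_banach_point_closed hconv
    CStarAlgebra.isClosed_nonneg (x := y) hcon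
  have hu : u < 0 := by simpa using hfb 0 (le_refl (0 : A))
  have hpos : ∀ a : A, 0 ≤ a → 0 ≤ f a := by
    intro a ha
    by_contra hneg
    push Not at hneg
    have := hfb ((u / f a) • a) (smul_nonneg (div_nonneg_of_nonpos hu.le hneg.le) ha)
    rw [map_smul, smul_eq_mul, div_mul_cancel₀ _ hneg.ne] at this
    exact lt_irrefl _ this
  have hfy : f y < 0 := hfu.trans hu
  have habs := pos_abs_le (g := (f : A →ₗ[ℝ] ℝ)) hpos hy
  have h1 : 0 < f 1 := by
    rcases (hpos 1 zero_le_one).lt_or_eq with h | h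
    · exact h
    · simp [← h] at habs
      exact absurd habs hfy.ne
  have := h ((f 1)⁻¹ • (f : A →ₗ[ℝ] ℝ)) ⟨by simp [h1.ne'], fun a ha => by
    simpa using mul_nonneg (inv_nonneg.2 h1.le) (hpos a ha)⟩
  have h3 : (0:ℝ) ≤ (f 1)⁻¹ * f y := by simpa using this
  nlinarith [inv_pos.2 h1]

variable {ι : Type*} [Fintype ι]

/-- the joint numerical range -/
def W (x : ι → A) : Set (EuclideanSpace ℝ ι) :=
  {v | ∃ g : A →ₗ[ℝ] ℝ, IsSt g ∧ ∀ i, v i = g (x i)}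

/-- approximable vectors -/
def P (σ : G →* (A →⋆ₐ[ℂ] A)) (x : ι → A) : Set (EuclideanSpace ℝ ι) :=
  {v | ∀ ε > (0 : ℝ), ∃ T ∈ elems σ, T 1 = 1 ∧ ∀ i, ‖T (x i) - v i • (1 : A)‖ ≤ ε}

lemma P_convex (σ : G →* (A →⋆ₐ[ℂ] A)) (x : ι → A) : Convex ℝ (P σ x) := by
  intro v hv w hw a b ha hb hab ε hε
  obtain ⟨T, hT, hT1, hTx⟩ := hv ε hε
  obtain ⟨S, hS, hS1, hSx⟩ := hw ε hε
  obtain ⟨T', hT', hTe⟩ := elems_smul σ hT ha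
  obtain ⟨S', hS', hSe⟩ := elems_smul σ hS hb
  refine ⟨T' + S', add_mem hT' hS', ?_, fun i => ?_⟩
  · simp [hTe, hSe, hT1, hS1, ← add_smul, hab]
  · have : (T' + S') (x i) - (a • v + b • w) i • (1 : A)
        = a • (T (x i) - v i • (1 : A)) + b • (S (x i) - w i • (1 : A)) := by
      simp only [LinearMap.add_apply, hTe, hSe, PiLp.add_apply, PiLp.smul_apply, smul_eq_mul,
        smul_sub, smul_smul, add_smul]
      abel
    rw [this]
    refine (norm_add_le _ _).trans ?_
    rw [norm_smul, norm_smul, Real.norm_of_nonneg ha, Real.norm_of_nonneg hb]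
    calc _ ≤ a * ε + b * ε := by gcongr; exacts [hTx i, hSx i]
      _ = ε := by rw [← add_mul, hab, one_mul]

lemma P_closed (σ : G →* (A →⋆ₐ[ℂ] A)) (x : ι → A) : IsClosed (P σ x) := by
  rw [← closure_subset_iff_isClosed]
  intro v hv ε hε
  rcases subsingleton_or_nontrivial A with hA | hA
  · exact ⟨0, zero_mem _, Subsingleton.elim _ _, fun i => by
      rw [Subsingleton.elim (_ - _ : A) 0]; simpa using hε.le⟩
  obtain ⟨w, hw, hd⟩ := Metric.mem_closure_iff.1 hv (ε / 2) (by positivity)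
  obtain ⟨T, hT, hT1, hTx⟩ := hw (ε / 2) (by positivity)
  refine ⟨T, hT, hT1, fun i => ?_⟩
  have h1 : T (x i) - v i • (1 : A) = (T (x i) - w i • (1 : A)) - (v i - w i) • (1 : A) := by
    rw [sub_smul]; abel
  rw [h1]
  refine (norm_sub_le _ _).trans ?_
  have h2 : ‖(v i - w i) • (1 : A)‖ ≤ ε / 2 := by
    rw [norm_smul, norm_one, mul_one]
    rw [dist_eq_norm] at hd
    exact (PiLp.norm_apply_le (v - w) i).trans hd.le
  linarith [hTx i]

lemma W_norm {x : ι → A} (hx : ∀ i, IsSelfAdjoint (x i)) {v : EuclideanSpace ℝ ι}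
    (hv : v ∈ W x) : ‖v‖ ≤ √(∑ i, ‖x i‖ ^ 2) := by
  obtain ⟨g, hg, h⟩ := hv
  rw [EuclideanSpace.norm_eq]
  gcongr with i
  rw [h i]
  simpa [hg.1] using pos_abs_le hg.2 (hx i)

open scoped RealInnerProductSpace in
lemma inner_eq (l v : EuclideanSpace ℝ ι) : ⟪l, v⟫ = ∑ i, l i * v i := by
  rw [PiLp.inner_apply]
  simp [mul_comm]

open scoped RealInnerProductSpace in
lemma exposed_mem (σ : G →* (A →⋆ₐ[ℂ] A))
    (hGsimple : ∀ I : Set A, IsClosed I → (0 : A) ∈ I →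
      (∀ a ∈ I, ∀ b ∈ I, a + b ∈ I) → (∀ a ∈ I, ∀ b : A, a * b ∈ I ∧ b * a ∈ I) →
      (∀ g : G, ∀ a ∈ I, σ g a ∈ I) → I = {0} ∨ I = Set.univ)
    {x : ι → A} (hx : ∀ i, IsSelfAdjoint (x i)) {v z : EuclideanSpace ℝ ι}
    (hv : v ∈ closure (W x)) (hz : ∀ u ∈ W x, ‖u - z‖ ≤ ‖v - z‖) : v ∈ P σ x := by
  intro ε hε
  set l := v - z with hl
  set δ := ε ^ 2 / 2 with hδ
  have hδ0 : 0 < δ := by positivity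
  set c := ⟪l, v⟫ - δ with hc
  have key : ∀ u ∈ W x, c ≤ ⟪l, u⟫ → ‖u - v‖ ≤ ε := by
    intro u hu hcu
    have h1 := hz u hu
    have h2 : ‖u - v‖ ^ 2 = ‖u - z‖ ^ 2 - 2 * ⟪u - z, l⟫ + ‖l‖ ^ 2 := by
      rw [← norm_sub_sq_real, hl]; congr 2; abel
    have h3 : ⟪u - z, l⟫ = ⟪l, u⟫ - ⟪l, v⟫ + ‖l‖ ^ 2 := by
      rw [real_inner_comm, ← real_inner_self_eq_norm_sq, ← inner_sub_right, ← inner_add_right]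
      congr 1; rw [hl]; abel
    have h4 : ‖u - z‖ ^ 2 ≤ ‖l‖ ^ 2 := by gcongr
    have h5 : ‖u - v‖ ^ 2 ≤ ε ^ 2 := by rw [h2, h3]; linarith
    exact le_of_sq_le_sq h5 hε.le
  set a : A := ∑ i, l i • x i with ha
  have hasa : IsSelfAdjoint a := by
    rw [ha, IsSelfAdjoint, star_sum]
    exact Finset.sum_congr rfl fun i _ => by rw [star_smul, (hx i).star_eq]; simp
  have hga : ∀ g : A →ₗ[ℝ] ℝ, ∀ u : EuclideanSpace ℝ ι, (∀ i, u i = g (x i)) →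
      ⟪l, u⟫ = g a := by
    intro g u hu
    rw [inner_eq, ha, map_sum]
    exact Finset.sum_congr rfl fun i _ => by rw [hu i]; simp
  set b : A := a - c • (1 : A) with hb
  have hbsa : IsSelfAdjoint b := hasa.sub ((IsSelfAdjoint.all c).smul (IsSelfAdjoint.one A))
  set h : A := b⁺ with hh
  have hh0 : 0 ≤ h := CFC.posPart_nonneg b
  have hhs : star h = h := (IsSelfAdjoint.of_nonneg hh0).star_eq
  have hbe : b⁺ - b⁻ = b := CFC.posPart_sub_negPart b hbsa
  have hhne : h ≠ 0 := by
    intro h0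
    have hb0 : b ≤ 0 := by
      rw [← hbe, ← hh, h0, zero_sub]
      exact neg_nonpos.2 (CFC.negPart_nonneg b)
    have hW : ∀ u ∈ W x, ⟪l, u⟫ ≤ c := by
      rintro u ⟨g, hg, hu⟩
      rw [hga g u hu]
      have := hg.2 (-b) (neg_nonneg.2 hb0)
      rw [hb] at this
      simp [hg.1] at this
      exact this
    have hcl : closure (W x) ⊆ {u | ⟪l, u⟫ ≤ c} :=
      closure_minimal hW (isClosed_le (by fun_prop) (by fun_prop))
    have : ⟪l, v⟫ ≤ c := hcl hv
    linarith
  have hhbh : c • (h * h) ≤ h * a * h := by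
    have e1 : h * b * h = h * h * h := by
      rw [← hbe, mul_sub, CFC.posPart_mul_negPart, sub_zero]
    have e2 : 0 ≤ h * h * h := by
      have := star_right_conjugate_nonneg hh0 h
      rwa [hhs] at this
    rw [← e1, hb] at e2
    rw [← sub_nonneg]
    convert e2 using 1
    simp [mul_sub, sub_mul]
  have hhh : 0 ≤ h * h := by
    have := mul_star_self_nonneg h
    rwa [hhs] at this
  have hhh0 : h * h ≠ 0 := by
    intro h0
    apply hhne
    rw [← CStarRing.star_mul_self_eq_zero_iff, hhs, h0]
  have hsax : ∀ i, IsSelfAdjoint (h * x i * h) := by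
    intro i
    have := (hx i).conjugate h
    rwa [hhs] at this
  have hstate : ∀ g : A →ₗ[ℝ] ℝ, IsSt g → ∀ i,
      |g (h * x i * h) - v i * g (h * h)| ≤ ε * g (h * h) := by
    intro g hg i
    set g' : A →ₗ[ℝ] ℝ := g ∘ₗ (LinearMap.mulRight ℝ h) ∘ₗ (LinearMap.mulLeft ℝ h) with hg'
    have hg'a : ∀ y, g' y = g (h * y * h) := fun y => rfl
    have hg'p : ∀ y, 0 ≤ y → 0 ≤ g' y := by
      intro y hy
      rw [hg'a]
      have := star_right_conjugate_nonneg hy h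
      rw [hhs] at this
      exact hg.2 _ this
    have hg'1 : g' 1 = g (h * h) := by rw [hg'a, mul_one]
    rcases (hg.2 _ hhh).eq_or_lt with h0 | h0
    · have := pos_abs_le hg'p (hx i)
      rw [hg'1, ← h0, hg'a] at this
      rw [← h0]
      simpa using this
    · set s := g (h * h) with hs
      set u : EuclideanSpace ℝ ι := WithLp.toLp 2 (fun i => s⁻¹ * g' (x i)) with hu
      have hst : IsSt (s⁻¹ • g') := ⟨by simp [hg'1, h0.ne'], fun y hy => by
        simpa using mul_nonneg (inv_nonneg.2 h0.le) (hg'p y hy)⟩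
      have hui : ∀ i, u i = (s⁻¹ • g') (x i) := fun i => by simp [hu]
      have hle : c ≤ ⟪l, u⟫ := by
        rw [hga _ u hui]
        have := hg.2 _ (sub_nonneg.2 hhbh)
        rw [map_sub, map_smul, ← hs, smul_eq_mul, ← hg'a] at this
        simp only [LinearMap.smul_apply, smul_eq_mul]
        rw [← div_eq_inv_mul, le_div_iff₀ h0]
        linarith
      have := (PiLp.norm_apply_le (u - v) i).trans (key u ⟨_, hst, hui⟩ hle)
      rw [PiLp.sub_apply, hui, Real.norm_eq_abs] at this
      simp only [LinearMap.smul_apply, smul_eq_mul, hg'a] at this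
      have e : g (h * x i * h) - v i * s = (s⁻¹ * g (h * x i * h) - v i) * s := by
        field_simp
      rw [e, abs_mul, abs_of_pos h0]
      gcongr
  obtain ⟨T, hT, hT1⟩ := full σ hGsimple hhh hhh0
  obtain ⟨S, hS, hSe⟩ := elems_comp σ hT h
  rw [hhs] at hSe
  have hTsm : ∀ (r : ℝ) y, T (r • y) = r • T y := fun r y => LinearMap.map_smul_of_tower T r y
  have hsah : IsSelfAdjoint (h * h) := IsSelfAdjoint.of_nonneg hhh
  refine ⟨S, hS, by rw [hSe, mul_one, hT1], fun i => ?_⟩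
  have hup : 0 ≤ ε • (h * h) - (h * x i * h - v i • (h * h)) := by
    refine nonneg_of_states (((IsSelfAdjoint.all ε).smul hsah).sub
      ((hsax i).sub ((IsSelfAdjoint.all _).smul hsah))) fun g hg => ?_
    have := (abs_le.1 (hstate g hg i)).2
    simp only [map_sub, map_smul, smul_eq_mul]
    linarith
  have hlo : 0 ≤ ε • (h * h) + (h * x i * h - v i • (h * h)) := by
    refine nonneg_of_states (((IsSelfAdjoint.all ε).smul hsah).add
      ((hsax i).sub ((IsSelfAdjoint.all _).smul hsah))) fun g hg => ?_
    have := (abs_le.1 (hstate g hg i)).1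
    simp only [map_sub, map_add, map_smul, smul_eq_mul]
    linarith
  have hup' := elems_nonneg σ hT hup
  have hlo' := elems_nonneg σ hT hlo
  simp only [map_sub, map_add, hTsm, hT1] at hup' hlo'
  rw [hSe]
  have hlo2 : -(ε • (1 : A)) ≤ T (h * x i * h) - v i • (1 : A) := by
    rw [← sub_nonneg]; convert hlo' using 1; abel
  refine norm_le_of_bounds hε.le ?_ (sub_nonneg.1 hup') hlo2
  have := (IsSelfAdjoint.of_nonneg hlo').sub
    ((IsSelfAdjoint.all ε).smul (IsSelfAdjoint.one A))
  simpa using this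

open scoped RealInnerProductSpace in
lemma W_subset_P (σ : G →* (A →⋆ₐ[ℂ] A))
    (hGsimple : ∀ I : Set A, IsClosed I → (0 : A) ∈ I →
      (∀ a ∈ I, ∀ b ∈ I, a + b ∈ I) → (∀ a ∈ I, ∀ b : A, a * b ∈ I ∧ b * a ∈ I) →
      (∀ g : G, ∀ a ∈ I, σ g a ∈ I) → I = {0} ∨ I = Set.univ)
    {x : ι → A} (hx : ∀ i, IsSelfAdjoint (x i)) : W x ⊆ P σ x := by
  intro w hw
  by_contra hwP
  obtain ⟨f, u, hfP, hfw⟩ := geometric_hahn_banach_closed_point (P_convex σ x) (P_closed σ x) hwP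
  set l := (InnerProductSpace.toDual ℝ (EuclideanSpace ℝ ι)).symm f with hl
  have hfl : ∀ y, f y = ⟪l, y⟫ := fun y => by
    rw [hl, InnerProductSpace.toDual_symm_apply]
  set C := √(∑ i, ‖x i‖ ^ 2) with hC
  have hWC : closure (W x) ⊆ Metric.closedBall 0 C :=
    closure_minimal (fun y hy => by simpa using W_norm hx hy) Metric.isClosed_closedBall
  have hcomp : IsCompact (closure (W x)) :=
    (isCompact_closedBall _ _).of_isClosed_subset isClosed_closure hWC
  set δ := f w - u with hδ
  have hδ0 : 0 < δ := sub_pos.2 hfw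
  set R := ((2 * C) ^ 2 + 1) / (2 * δ) with hR
  have hR0 : 0 ≤ R := by positivity
  set z := w - R • l with hz
  obtain ⟨v, hv, hmax⟩ := hcomp.exists_isMaxOn ⟨w, subset_closure hw⟩
    (f := fun y => ‖y - z‖) (by fun_prop)
  have hvP := exposed_mem σ hGsimple hx hv (fun y hy => hmax (subset_closure hy))
  have h1 := hfP v hvP
  have h2 : ‖w - z‖ ≤ ‖v - z‖ := hmax (subset_closure hw)
  have hwz : w - z = R • l := by rw [hz]; abel
  have hvz : v - z = (v - w) + R • l := by rw [hz]; abel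
  rw [hwz, hvz] at h2
  have h3 : ‖R • l‖ ^ 2 ≤ ‖(v - w) + R • l‖ ^ 2 := by gcongr
  rw [norm_add_sq_real, inner_smul_right, real_inner_comm, inner_sub_right, ← hfl, ← hfl] at h3
  have h4 : ‖v - w‖ ≤ 2 * C := by
    have := mem_closedBall_zero_iff.1 (hWC hv)
    have := W_norm hx hw
    linarith [norm_sub_le v w]
  have h5 : ‖v - w‖ ^ 2 ≤ (2 * C) ^ 2 := by gcongr
  have h6 : R * (2 * δ) = (2 * C) ^ 2 + 1 := by rw [hR]; field_simp
  have h7 : f v - f w < -δ := by linarith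
  have h8 : R * (f v - f w) ≤ R * (-δ) := by gcongr
  linarith

end

end ElemUCP

/- STATEMENT 5: In a `G`-simple unital C*-algebra `A`, every state `φ` can be
approximated, uniformly on finite sets, by unital completely positive elementary maps
of the form `x ↦ Σ bⱼ σ_{tⱼ}(x) bⱼ*` (the existence of the approximating net is
expressed by its canonical `ε`-finite-set formulation). -/
theorem state_approx_by_elementary_ucp_maps_of_GSimple
    {G A : Type*} [Group G] [CStarAlgebra A]
    (σ : G →* (A →⋆ₐ[ℂ] A))
    (hGsimple : ∀ I : Set A, IsClosed I → (0 : A) ∈ I →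
      (∀ a ∈ I, ∀ b ∈ I, a + b ∈ I) → (∀ a ∈ I, ∀ b : A, a * b ∈ I ∧ b * a ∈ I) →
      (∀ g : G, ∀ a ∈ I, σ g a ∈ I) → I = {0} ∨ I = Set.univ)
    (φ : A →L[ℂ] ℂ) (hφ_unital : φ 1 = 1) (hφ_pos : ∀ a : A, 0 ≤ φ (star a * a)) :
    ∀ ε > (0 : ℝ), ∀ F : Finset A,
      ∃ (m : ℕ) (b : Fin m → A) (t : Fin m → G),
        (∑ j, b j * star (b j)) = 1 ∧
        ∀ a ∈ F, ‖(∑ j, b j * σ (t j) a * star (b j)) - φ a • (1 : A)‖ ≤ ε := by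
  intro ε hε F
  letI := CStarAlgebra.spectralOrder A
  haveI := CStarAlgebra.spectralOrderedRing A
  have hpos : ∀ y : A, 0 ≤ y → 0 ≤ φ y := by
    intro y hy
    obtain ⟨b, rfl⟩ := CStarAlgebra.nonneg_iff_eq_star_mul_self.1 hy
    exact hφ_pos b
  have him : ∀ y : A, IsSelfAdjoint y → φ y = ((φ y).re : ℂ) := by
    intro y hy
    have h1 := hpos _ (CFC.posPart_nonneg y)
    have h2 := hpos _ (CFC.negPart_nonneg y)
    rw [Complex.nonneg_iff] at h1 h2
    have h3 := congrArg φ (CFC.posPart_sub_negPart y hy)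
    rw [map_sub] at h3
    apply Complex.ext
    · simp
    · rw [← h3]; simp [← h1.2, ← h2.2]
  let g : A →ₗ[ℝ] ℝ := Complex.reLm ∘ₗ (φ.toLinearMap.restrictScalars ℝ)
  have hg : ElemUCP.IsSt g :=
    ⟨by simp [g, hφ_unital], fun y hy => (Complex.nonneg_iff.1 (hpos y hy)).1⟩
  let x : F ⊕ F → A := Sum.elim (fun a => (realPart (a : A) : A)) (fun a => (imaginaryPart (a : A) : A))
  have hx : ∀ i, IsSelfAdjoint (x i) := by
    rintro (a | a)
    · exact (realPart (a : A)).2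
    · exact (imaginaryPart (a : A)).2
  have hw : (WithLp.toLp 2 (fun i => g (x i)) : EuclideanSpace ℝ (F ⊕ F)) ∈ ElemUCP.W x :=
    ⟨g, hg, fun i => rfl⟩
  obtain ⟨T, hT, hT1, hTx⟩ := ElemUCP.W_subset_P σ hGsimple hx hw (ε / 2) (by positivity)
  obtain ⟨m, b, t, hrep⟩ := ElemUCP.elems_repr σ hT
  refine ⟨m, b, t, ?_, fun a ha => ?_⟩
  · rw [← hT1, hrep]; simp
  rw [← hrep]
  have h1 := hTx (Sum.inl ⟨a, ha⟩)
  have h2 := hTx (Sum.inr ⟨a, ha⟩)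
  change ‖T (realPart a : A) - (φ (realPart a : A)).re • (1 : A)‖ ≤ ε / 2 at h1
  change ‖T (imaginaryPart a : A) - (φ (imaginaryPart a : A)).re • (1 : A)‖ ≤ ε / 2 at h2
  rw [← Complex.coe_smul, ← him _ (realPart a).2] at h1
  rw [← Complex.coe_smul, ← him _ (imaginaryPart a).2] at h2
  have e : T a - φ a • (1 : A) = (T (realPart a : A) - φ (realPart a : A) • (1 : A))
      + Complex.I • (T (imaginaryPart a : A) - φ (imaginaryPart a : A) • (1 : A)) := by
    conv_lhs => rw [← realPart_add_I_smul_imaginaryPart a]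
    simp only [map_add, map_smul, smul_sub, add_smul, smul_eq_mul, mul_smul]
    abel
  rw [e]
  refine (norm_add_le _ _).trans ?_
  rw [norm_smul, Complex.norm_I, one_mul]
  linarith
end

section
/- Let G be a discrete group acting continuously on a compact Hausdorff space X and by *-automorphisms on a unital C*-algebra B. Let 𝓒 ⊆ C(X,B) be a G-invariant closed *-subalgebra (for the diagonal action), and let 𝓑̃ ⊆ B be a G-invariant closed *-subalgebra such that every constant function x ↦ b̃ (b̃ ∈ 𝓑̃) lies in the closed *-subalgebra of C(X,B) generated by 𝓒 together with C(X). Suppose there is a subgroup Γ ≤ G such that the action Γ ↷ X is strongly proximal and Γ acts trivially on 𝓑̃. Then every constant function x ↦ b̃ with b̃ ∈ 𝓑̃ belongs to 𝓒. -/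
open MeasureTheory

/-- The embedding of `C(X)` into `C(X,B)`, `g ↦ (x ↦ g x • 1)`. -/
noncomputable def embedScalar {X : Type*} (B : Type*) [TopologicalSpace X] [CStarAlgebra B]
    (g : C(X, ℂ)) : C(X, B) :=
  ⟨fun x => g x • (1 : B), g.continuous.smul continuous_const⟩

theorem MonoidHom.starAlgHom_leftInv {G B : Type*} [Group G] [CStarAlgebra B]
    (σ : G →* (B →⋆ₐ[ℂ] B)) (g : G) (b : B) : σ g⁻¹ (σ g b) = b := by
  have h : σ g⁻¹ * σ g = 1 := by rw [← map_mul, inv_mul_cancel, map_one]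
  calc σ g⁻¹ (σ g b) = (σ g⁻¹ * σ g) b := rfl
    _ = b := by rw [h]; rfl

/-- An action of a group by *-endomorphisms consists of isometric *-automorphisms, so
each of them is continuous. -/
theorem MonoidHom.starAlgHom_continuous {G B : Type*} [Group G] [CStarAlgebra B]
    (σ : G →* (B →⋆ₐ[ℂ] B)) (g : G) : Continuous (σ g) :=
  (NonUnitalStarAlgHom.isometry (σ g)
    (Function.LeftInverse.injective (MonoidHom.starAlgHom_leftInv σ g))).continuous

/-- The diagonal action of `G` on `C(X,B)`: `(s • f) x = σ_s (f (s⁻¹ • x))`. -/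
noncomputable def diagAct {G X B : Type*} [Group G] [TopologicalSpace X]
    [MulAction G X] [CStarAlgebra B] (hc : ∀ s : G, Continuous fun x : X => s • x)
    (σ : G →* (B →⋆ₐ[ℂ] B)) (s : G) (f : C(X, B)) : C(X, B) :=
  ⟨fun x => σ s (f (s⁻¹ • x)),
    (MonoidHom.starAlgHom_continuous σ s).comp (f.continuous.comp (hc s⁻¹))⟩

/-- Representing measure of a normalized positive functional on `C(X, ℝ)`. -/
theorem exists_probMeasure_of_pos {X : Type*} [TopologicalSpace X] [CompactSpace X] [T2Space X]
    [MeasurableSpace X] [BorelSpace X] (f : C(X, ℝ) →ₗ[ℝ] ℝ)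
    (hf : ∀ g : C(X, ℝ), 0 ≤ g → 0 ≤ f g) (h1 : f 1 = 1) :
    ∃ ν : ProbabilityMeasure X, ∀ g : C(X, ℝ), ∫ x, g x ∂(ν : Measure X) = f g := by
  let L : CompactlySupportedContinuousMap X ℝ →ₗ[ℝ] ℝ :=
    { toFun := fun g => f (g : C(X, ℝ))
      map_add' := fun a b => by
        rw [← map_add]; rfl
      map_smul' := fun c a => by
        rw [RingHom.id_apply, ← map_smul]; rfl }
  let Λ : CompactlySupportedContinuousMap X ℝ →ₚ[ℝ] ℝ :=
    PositiveLinearMap.mk₀ L (fun g hg => hf _ (fun x => hg x))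
  have key : ∀ g : C(X, ℝ), ∫ x, g x ∂(RealRMK.rieszMeasure Λ) = f g := fun g => by
    have := RealRMK.integral_rieszMeasure Λ (CompactlySupportedContinuousMap.continuousMapEquiv g)
    exact this
  have : IsProbabilityMeasure (RealRMK.rieszMeasure Λ) := by
    have h := key 1
    rw [h1] at h
    simp only [ContinuousMap.one_apply, integral_const, smul_eq_mul, mul_one] at h
    constructor
    rw [Measure.real, ENNReal.toReal_eq_one_iff] at h
    exact h
  exact ⟨⟨_, this⟩, key⟩

/-- A minimax principle: if every probability measure has integral `< ε` on some member of a
convex set of continuous functions then some member of that set is `< ε` everywhere. -/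
theorem exists_forall_lt_of_forall_measure {X : Type*} [TopologicalSpace X] [CompactSpace X]
    [T2Space X] [MeasurableSpace X] [BorelSpace X] (T : Set C(X, ℝ)) (hT : Convex ℝ T)
    (hne : T.Nonempty) (ε : ℝ) (hε : 0 < ε)
    (h : ∀ ν : ProbabilityMeasure X, ∃ g ∈ T, ∫ x, g x ∂(ν : Measure X) < ε) :
    ∃ g ∈ T, ∀ y, g y < ε := by
  by_contra hcon
  push Not at hcon
  have hO : IsOpen {g : C(X, ℝ) | ∀ y, g y < ε} := by
    have := ContinuousMap.isOpen_setOfPred_mapsTo (X := X) (Y := ℝ) isCompact_univ (isOpen_Iio (a := ε))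
    simpa [Set.MapsTo] using this
  have hOc : Convex ℝ {g : C(X, ℝ) | ∀ y, g y < ε} := by
    intro a ha b hb s t hs ht hst y
    exact (convex_Iio ε) (ha y) (hb y) hs ht hst
  obtain ⟨f, u, hfu, huf⟩ := geometric_hahn_banach_open hOc hO hT (by
    rw [Set.disjoint_left]
    intro g hg hgT
    obtain ⟨y, hy⟩ := hcon g hgT
    exact absurd (hg y) (not_lt.2 hy))
  have hu : 0 < u := by simpa using hfu 0 (fun y => by simpa using hε)
  have hpos : ∀ g : C(X, ℝ), 0 ≤ g → 0 ≤ f g := by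
    intro g hg
    by_contra hneg
    push Not at hneg
    have h2 := hfu ((u / f g) • g) (fun y => by
      have h3 : u / f g ≤ 0 := div_nonpos_of_nonneg_of_nonpos hu.le hneg.le
      have h4 : (u / f g) * g y ≤ 0 := mul_nonpos_of_nonpos_of_nonneg h3 (hg y)
      simp only [ContinuousMap.smul_apply, smul_eq_mul]
      linarith)
    rw [map_smul, smul_eq_mul, div_mul_cancel₀ _ hneg.ne] at h2
    exact lt_irrefl _ h2
  have hf1 : 0 < f 1 := by
    obtain ⟨g, hg⟩ := hne
    have h2 := hpos (‖g‖ • 1 - g) (fun y => by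
      have := (le_abs_self _).trans (g.norm_coe_le_norm y)
      simpa using this)
    rw [map_sub, map_smul, smul_eq_mul] at h2
    have h3 := huf g hg
    have h4 : 0 < ‖g‖ * f 1 := by linarith
    exact pos_of_mul_pos_right h4 (norm_nonneg _)
  have hεu : ε * f 1 ≤ u := by
    by_contra hlt
    push Not at hlt
    have h2 := hfu ((u / f 1) • 1) (fun y => by
      simp only [ContinuousMap.smul_apply, smul_eq_mul, ContinuousMap.one_apply, mul_one]
      rwa [div_lt_iff₀ hf1])
    rw [map_smul, smul_eq_mul, div_mul_cancel₀ _ hf1.ne'] at h2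
    exact lt_irrefl _ h2
  obtain ⟨ν, hν⟩ := exists_probMeasure_of_pos ((f 1)⁻¹ • (f : C(X, ℝ) →ₗ[ℝ] ℝ))
    (fun g hg => mul_nonneg (inv_nonneg.2 hf1.le) (hpos g hg))
    (inv_mul_cancel₀ hf1.ne')
  obtain ⟨g, hg, hlt⟩ := h ν
  rw [hν g] at hlt
  have h3 := huf g hg
  have h4 : (f 1)⁻¹ * f g < ε := hlt
  rw [inv_mul_lt_iff₀ hf1] at h4
  linarith

/-- Elements of the algebra generated by `𝓒` and `C(X)` are diagonals of continuous maps
`X → 𝓒`. -/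
theorem exists_diag_of_mem_adjoin {X B : Type*} [TopologicalSpace X] [CompactSpace X]
    [CStarAlgebra B] (𝓒 : StarSubalgebra ℂ C(X, B)) (F : C(X, B))
    (hF : F ∈ StarAlgebra.adjoin ℂ
        ((𝓒 : Set C(X, B)) ∪ Set.range (embedScalar B (X := X)))) :
    ∃ Φ : C(X, C(X, B)), (∀ x, Φ x ∈ 𝓒) ∧ ∀ x, F x = Φ x x := by
  induction hF using StarAlgebra.adjoin_induction with
  | mem f hf =>
    rcases hf with hf | ⟨g, rfl⟩
    · exact ⟨ContinuousMap.const X f, fun _ => hf, fun _ => rfl⟩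
    · refine ⟨⟨fun x => g x • (1 : C(X, B)), g.continuous.smul continuous_const⟩,
        fun x => 𝓒.smul_mem 𝓒.one_mem _, fun x => rfl⟩
  | algebraMap r =>
    exact ⟨ContinuousMap.const X (algebraMap ℂ _ r), fun _ => 𝓒.algebraMap_mem r, fun _ => rfl⟩
  | add x y _ _ hx hy =>
    obtain ⟨Φ, h1, h2⟩ := hx
    obtain ⟨Ψ, h3, h4⟩ := hy
    exact ⟨Φ + Ψ, fun x => 𝓒.add_mem (h1 x) (h3 x), fun x => by simp [h2, h4]⟩
  | mul x y _ _ hx hy =>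
    obtain ⟨Φ, h1, h2⟩ := hx
    obtain ⟨Ψ, h3, h4⟩ := hy
    exact ⟨Φ * Ψ, fun x => 𝓒.mul_mem (h1 x) (h3 x), fun x => by simp [h2, h4]⟩
  | star x _ hx =>
    obtain ⟨Φ, h1, h2⟩ := hx
    exact ⟨star Φ, fun x => star_mem (h1 x), fun x => by simp [h2]⟩

/- STATEMENT 6: If `𝓒 ⊆ C(X,B)` is `G`-invariant, `𝓑̃ ⊆ B` is a `G`-invariant
subalgebra whose constants lie in the closed *-algebra generated by `𝓒` and `C(X)`,
and some subgroup `Γ ≤ G` acts strongly proximally on `X` and trivially on `𝓑̃`,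
then the constants from `𝓑̃` already lie in `𝓒`. -/
theorem const_mem_of_stronglyProximal_subgroup
    {G X B : Type*} [Group G] [TopologicalSpace X] [CompactSpace X] [T2Space X]
    [MeasurableSpace X] [BorelSpace X] [MulAction G X]
    (hc : ∀ s : G, Continuous fun x : X => s • x)
    [CStarAlgebra B] (σ : G →* (B →⋆ₐ[ℂ] B))
    (𝓒 : StarSubalgebra ℂ C(X, B)) (h𝓒closed : IsClosed (𝓒 : Set C(X, B)))
    (h𝓒inv : ∀ s : G, ∀ f ∈ 𝓒, diagAct hc σ s f ∈ 𝓒)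
    (𝓑t : StarSubalgebra ℂ B) (h𝓑closed : IsClosed (𝓑t : Set B))
    (h𝓑inv : ∀ s : G, ∀ b ∈ 𝓑t, σ s b ∈ 𝓑t)
    (hgen : ∀ b ∈ 𝓑t, ContinuousMap.const X b ∈
      (StarAlgebra.adjoin ℂ
        ((𝓒 : Set C(X, B)) ∪ Set.range (embedScalar B (X := X)))).topologicalClosure)
    (Γ : Subgroup G)
    (hprox : ∀ ν : ProbabilityMeasure X, ∃ x : X,
      (⟨Measure.dirac x, Measure.dirac.isProbabilityMeasure⟩ : ProbabilityMeasure X) ∈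
        closure {μ : ProbabilityMeasure X |
          ∃ s : Γ, μ = ν.map (hc (s : G)).measurable.aemeasurable})
    (htriv : ∀ s : Γ, ∀ b ∈ 𝓑t, σ (s : G) b = b) :
    ∀ b ∈ 𝓑t, ContinuousMap.const X b ∈ 𝓒 := by
  intro b hb
  rcases isEmpty_or_nonempty X with hX | ⟨⟨x₀⟩⟩
  · have : ContinuousMap.const X b = 0 := by ext x; exact hX.elim x
    rw [this]; exact 𝓒.zero_mem
  suffices hmain : ContinuousMap.const X b ∈ closure (𝓒 : Set C(X, B)) by
    rwa [h𝓒closed.closure_eq] at hmain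
  rw [Metric.mem_closure_iff]
  intro ε hε
  have hb' : ContinuousMap.const X b ∈ closure ((StarAlgebra.adjoin ℂ
        ((𝓒 : Set C(X, B)) ∪ Set.range (embedScalar B (X := X))) : Set C(X, B))) := hgen b hb
  obtain ⟨F, hF, hdF⟩ := Metric.mem_closure_iff.1 hb' (ε / 3) (by positivity)
  obtain ⟨Φ, hΦ, hFΦ⟩ := exists_diag_of_mem_adjoin 𝓒 F hF
  let T : Set C(X, ℝ) := {h | ∃ c ∈ 𝓒, ∀ y, ‖b - c y‖ ≤ ε / 3 + h y}
  have hTc : Convex ℝ T := by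
    rintro h₁ ⟨c₁, hc₁, hh₁⟩ h₂ ⟨c₂, hc₂, hh₂⟩ s t hs ht hst
    refine ⟨(s : ℂ) • c₁ + (t : ℂ) • c₂,
      𝓒.add_mem (𝓒.smul_mem hc₁ _) (𝓒.smul_mem hc₂ _), fun y => ?_⟩
    have e : b - ((s : ℂ) • c₁ + (t : ℂ) • c₂) y
        = (s : ℂ) • (b - c₁ y) + (t : ℂ) • (b - c₂ y) := by
      have hst' : (s : ℂ) + t = 1 := by exact_mod_cast hst
      simp only [ContinuousMap.add_apply, ContinuousMap.smul_apply, smul_sub]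
      nth_rewrite 1 [← one_smul ℂ b]
      rw [← hst', add_smul]
      abel
    rw [e]
    refine (norm_add_le _ _).trans ?_
    rw [norm_smul, norm_smul, Complex.norm_real, Complex.norm_real, Real.norm_of_nonneg hs,
      Real.norm_of_nonneg ht]
    simp only [ContinuousMap.add_apply, ContinuousMap.smul_apply, smul_eq_mul]
    have a1 := mul_le_mul_of_nonneg_left (hh₁ y) hs
    have a2 := mul_le_mul_of_nonneg_left (hh₂ y) ht
    have a3 : s * (ε / 3) + t * (ε / 3) = ε / 3 := by rw [← add_mul, hst, one_mul]
    linarith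
  let k : X → C(X, ℝ) := fun x => ⟨fun z => ‖Φ z - Φ x‖, by fun_prop⟩
  have hk : ∀ (s : Γ) (x : X), (k x).comp ⟨fun y => (s : G) • y, hc s⟩ ∈ T := by
    intro s x
    refine ⟨diagAct hc σ ((s : G)⁻¹) (Φ x), h𝓒inv _ _ (hΦ x), fun y => ?_⟩
    have hs : σ ((s : G)⁻¹) b = b := htriv s⁻¹ b hb
    have e : b - diagAct hc σ ((s : G)⁻¹) (Φ x) y
        = σ ((s : G)⁻¹) (b - Φ x ((s : G) • y)) := by
      rw [map_sub, hs]
      simp [diagAct]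
    have hle : ∀ a : B, ‖σ ((s : G)⁻¹) a‖ ≤ ‖a‖ := fun a =>
      NonUnitalStarAlgHom.norm_apply_le (σ ((s : G)⁻¹)) a
    rw [e]
    refine (hle _).trans ?_
    have e2 : b - Φ x ((s : G) • y) = (b - F ((s : G) • y))
        + (Φ ((s : G) • y) - Φ x) ((s : G) • y) := by
      rw [hFΦ, ContinuousMap.sub_apply]; abel
    rw [e2]
    refine (norm_add_le _ _).trans (add_le_add ?_ ?_)
    · have := (ContinuousMap.dist_apply_le_dist (f := ContinuousMap.const X b) (g := F)
        ((s : G) • y)).trans hdF.le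
      rwa [dist_eq_norm] at this
    · exact ContinuousMap.norm_coe_le_norm _ _
  obtain ⟨g, ⟨c, hcC, hcg⟩, hg⟩ := exists_forall_lt_of_forall_measure T hTc ⟨_, hk 1 x₀⟩ (ε / 3)
    (by positivity) (by
    intro ν
    obtain ⟨x, hx⟩ := hprox ν
    have hopen : IsOpen {μ : ProbabilityMeasure X | ∫ z, k x z ∂(μ : Measure X) < ε / 3} :=
      isOpen_lt (ProbabilityMeasure.continuous_integral_continuousMap (k x)) continuous_const
    obtain ⟨μ, hμ, s, rfl⟩ := (mem_closure_iff (X := ProbabilityMeasure X)).1 hx _ hopen (by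
      change ∫ z, k x z ∂(Measure.dirac x) < ε / 3
      rw [integral_dirac]
      simp only [k, ContinuousMap.coe_mk, sub_self, norm_zero]
      positivity)
    refine ⟨_, hk s x, ?_⟩
    have hμ' : ∫ z, k x z ∂((ν : Measure X).map (fun y => (s : G) • y)) < ε / 3 := hμ
    rwa [integral_map (hc (s : G)).measurable.aemeasurable
      (k x).continuous.aestronglyMeasurable] at hμ')
  refine ⟨c, hcC, ?_⟩
  refine lt_of_le_of_lt ((ContinuousMap.dist_le (by positivity : (0 : ℝ) ≤ 2 * ε / 3)).2
    fun y => ?_) (by linarith : 2 * ε / 3 < ε)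
  rw [dist_eq_norm]
  have h1 := hcg y
  have h2 := hg y
  simp only [ContinuousMap.const_apply]
  linarith
end

section
/- Let G be a discrete group acting minimally and continuously on compact Hausdorff spaces X and Y such that the diagonal action G ↷ X×Y is not minimal, and let Z be a nonempty proper closed G-invariant subset of X×Y. Let I := {f ∈ C(X×Y) : f|_Z = 0} and W := C(Y) + I = {g∘pr_Y + f : g ∈ C(Y), f ∈ I}. Then W = C(X×Y) if and only if there exists a continuous G-equivariant surjection φ : Y → X such that Z = {(φ(y), y) : y ∈ Y}. -/
/- STATEMENT 11: With `G ↷ X, Y` minimal, `G ↷ X×Y` not minimal, `Z ⊊ X×Y` a nonempty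
closed invariant subset, `I` the ideal of functions vanishing on `Z`, and
`W = C(Y) + I`, one has `W = C(X×Y)` iff `Z` is the graph of a continuous
`G`-equivariant surjection `φ : Y → X`. -/
theorem cY_plus_vanishing_ideal_eq_top_iff_graph
    {G X Y : Type*} [Group G] [TopologicalSpace X] [CompactSpace X] [T2Space X]
    [TopologicalSpace Y] [CompactSpace Y] [T2Space Y] [MulAction G X] [MulAction G Y]
    (hcX : ∀ s : G, Continuous fun x : X => s • x)
    (hcY : ∀ s : G, Continuous fun y : Y => s • y)
    (hminX : ∀ x : X, Dense {x' : X | ∃ s : G, x' = s • x})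
    (hminY : ∀ y : Y, Dense {y' : Y | ∃ s : G, y' = s • y})
    (hnotmin : ¬ ∀ p : X × Y, Dense {q : X × Y | ∃ s : G, q = (s • p.1, s • p.2)})
    (Z : Set (X × Y)) (hZne : Z.Nonempty) (hZproper : Z ≠ Set.univ) (hZclosed : IsClosed Z)
    (hZinv : ∀ s : G, ∀ p ∈ Z, (s • p.1, s • p.2) ∈ Z) :
    {w : C(X × Y, ℂ) | ∃ g : C(Y, ℂ), ∃ f : C(X × Y, ℂ), (∀ p ∈ Z, f p = 0) ∧
        w = g.comp ⟨Prod.snd, continuous_snd⟩ + f} = Set.univ ↔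
      ∃ φ : Y → X, Continuous φ ∧ (∀ (s : G) (y : Y), φ (s • y) = s • φ y) ∧
        Function.Surjective φ ∧ Z = {p : X × Y | ∃ y : Y, p = (φ y, y)} := by
  constructor
  · intro hW
    have hinj : ∀ x x' : X, ∀ y : Y, (x, y) ∈ Z → (x', y) ∈ Z → x = x' := by
      intro x x' y hx hx'
      by_contra hne
      obtain ⟨h, h0, h1, -⟩ := exists_continuous_zero_one_of_isClosed
        (isClosed_singleton (x := x)) (isClosed_singleton (x := x'))
        (Set.disjoint_singleton.mpr hne)
      let w : C(X × Y, ℂ) := ⟨fun p => ((h p.1 : ℝ) : ℂ), by fun_prop⟩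
      have hw : w ∈ (Set.univ : Set C(X × Y, ℂ)) := Set.mem_univ _
      rw [← hW] at hw
      obtain ⟨g, f, hf, hwe⟩ := hw
      have e1 : ((h x : ℝ) : ℂ) = g y + f (x, y) := DFunLike.congr_fun hwe (x, y)
      have e2 : ((h x' : ℝ) : ℂ) = g y + f (x', y) := DFunLike.congr_fun hwe (x', y)
      rw [hf _ hx, h0 rfl] at e1
      rw [hf _ hx', h1 rfl, ← e1] at e2
      simp at e2
    have hclo : ∀ C : Set (X × Y), IsClosed C → IsClosed (Prod.snd '' C) := fun C hC =>
      (hC.isCompact.image continuous_snd).isClosed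
    have hsur : ∀ y : Y, ∃ x : X, (x, y) ∈ Z := by
      obtain ⟨⟨x0, y0⟩, hp⟩ := hZne
      have hd : Dense (Prod.snd '' Z) := (hminY y0).mono (by
        rintro _ ⟨s, rfl⟩
        exact ⟨_, hZinv s _ hp, rfl⟩)
      intro y
      have hy : y ∈ Prod.snd '' Z := by
        rw [← (hclo Z hZclosed).closure_eq]; exact hd y
      obtain ⟨⟨x, y'⟩, hz, rfl⟩ := hy
      exact ⟨x, hz⟩
    choose φ hφ using hsur
    have hcont : Continuous φ := by
      rw [continuous_iff_isClosed]
      intro C hC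
      have : φ ⁻¹' C = Prod.snd '' (Z ∩ Prod.fst ⁻¹' C) := by
        ext y
        constructor
        · intro hy
          exact ⟨(φ y, y), ⟨hφ y, hy⟩, rfl⟩
        · rintro ⟨⟨x, y'⟩, ⟨hz, hx⟩, rfl⟩
          have := hinj _ _ _ (hφ y') hz
          change φ y' ∈ C
          rw [this]; exact hx
      rw [this]
      exact hclo _ (hZclosed.inter (hC.preimage continuous_fst))
    have heq : ∀ (s : G) (y : Y), φ (s • y) = s • φ y := fun s y =>
      hinj _ _ _ (hφ (s • y)) (hZinv s _ (hφ y))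
    refine ⟨φ, hcont, heq, ?_, ?_⟩
    · obtain ⟨⟨x0, y0⟩, -⟩ := hZne
      have hd : Dense (Set.range φ) := (hminX (φ y0)).mono (by
        rintro _ ⟨s, rfl⟩
        exact ⟨s • y0, heq s y0⟩)
      intro x
      have hx : x ∈ closure (Set.range φ) := hd x
      rwa [(isCompact_range hcont).isClosed.closure_eq] at hx
    · ext ⟨x, y⟩
      constructor
      · intro hz
        exact ⟨y, by rw [hinj _ _ _ hz (hφ y)]⟩
      · rintro ⟨y', h⟩
        rw [h]; exact hφ y'
  · rintro ⟨φ, hc, -, -, rfl⟩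
    refine Set.eq_univ_of_forall fun w => ?_
    let g : C(Y, ℂ) := ⟨fun y => w (φ y, y), by fun_prop⟩
    refine ⟨g, w - g.comp ⟨Prod.snd, continuous_snd⟩, ?_, by simp⟩
    rintro _ ⟨y, rfl⟩
    simp [g]
end

section
/- Let G be a discrete group acting minimally and continuously on compact Hausdorff spaces X and Y such that the diagonal action G ↷ X×Y is not minimal, and let Z be a nonempty proper closed G-invariant subset of X×Y. Let I := {f ∈ C(X×Y) : f|_Z = 0} and W := C(Y) + I. Suppose there exists a closed G-invariant equivalence relation ~ on X such that W = {f ∈ C(X×Y) : f(x,y) = f(x',y) for all y ∈ Y whenever x ~ x'} (i.e., W = C(X'×Y) for a G-factor X' of X). Then ~ is the equality relation (so W = C(X×Y)), and there exists a continuous surjection φ : Y → X such that Z = {(φ(y), y) : y ∈ Y}. -/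
/- STATEMENT 12: In the setting of Statement 11, if `W = C(Y) + I` splits as
`C(X/~) ⊗min C(Y)` for some closed `G`-invariant equivalence relation `~` on `X`, then
`~` is equality (so `W = C(X×Y)`), and `Z` is the graph of a continuous surjection
`φ : Y → X`. -/
theorem splitting_of_cY_plus_vanishing_ideal_forces_graph
    {G X Y : Type*} [Group G] [TopologicalSpace X] [CompactSpace X] [T2Space X]
    [TopologicalSpace Y] [CompactSpace Y] [T2Space Y] [MulAction G X] [MulAction G Y]
    (hcX : ∀ s : G, Continuous fun x : X => s • x)
    (hcY : ∀ s : G, Continuous fun y : Y => s • y)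
    (hminX : ∀ x : X, Dense {x' : X | ∃ s : G, x' = s • x})
    (hminY : ∀ y : Y, Dense {y' : Y | ∃ s : G, y' = s • y})
    (hnotmin : ¬ ∀ p : X × Y, Dense {q : X × Y | ∃ s : G, q = (s • p.1, s • p.2)})
    (Z : Set (X × Y)) (hZne : Z.Nonempty) (hZproper : Z ≠ Set.univ) (hZclosed : IsClosed Z)
    (hZinv : ∀ s : G, ∀ p ∈ Z, (s • p.1, s • p.2) ∈ Z)
    (r : X → X → Prop) (hr : Equivalence r) (hrclosed : IsClosed {p : X × X | r p.1 p.2})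
    (hrinv : ∀ (s : G) (x x' : X), r x x' → r (s • x) (s • x'))
    (hW : {w : C(X × Y, ℂ) | ∃ g : C(Y, ℂ), ∃ f : C(X × Y, ℂ), (∀ p ∈ Z, f p = 0) ∧
        w = g.comp ⟨Prod.snd, continuous_snd⟩ + f} =
      {f : C(X × Y, ℂ) | ∀ x x' : X, r x x' → ∀ y : Y, f (x, y) = f (x', y)}) :
    (∀ x x' : X, r x x' ↔ x = x') ∧
      ∃ φ : Y → X, Continuous φ ∧ Function.Surjective φ ∧
        Z = {p : X × Y | ∃ y : Y, p = (φ y, y)} := by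
  classical
  have ury : ∀ (K : Set (X × Y)) (p : X × Y), IsClosed K → p ∉ K →
      ∃ f : C(X × Y, ℂ), (∀ q ∈ K, f q = 0) ∧ f p = 1 := by
    intro K p hK hp
    obtain ⟨f, h0, h1, -⟩ := exists_continuous_zero_one_of_isClosed hK
      (isClosed_singleton (x := p)) (Set.disjoint_singleton_right.2 hp)
    refine ⟨⟨fun q => (f q : ℂ), Complex.continuous_ofReal.comp f.continuous⟩, ?_, ?_⟩
    · intro q hq
      simp [h0 hq]
    · simp [h1 (Set.mem_singleton p)]
  have hreq : ∀ x x' : X, r x x' → x = x' := by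
    intro x x' hxx
    by_contra hne
    apply hZproper
    have hxZ : ∀ y : Y, (x, y) ∈ Z := by
      intro y
      by_contra hy
      obtain ⟨f, hf0, hf1⟩ := ury (Z ∪ {(x', y)}) (x, y)
        (hZclosed.union isClosed_singleton) (by simp [hy, hne])
      have hfW : f ∈ {f : C(X × Y, ℂ) | ∀ x x' : X, r x x' → ∀ y : Y, f (x, y) = f (x', y)} := by
        rw [← hW]
        refine ⟨0, f, fun p hp => hf0 p (Or.inl hp), ?_⟩
        ext p
        simp
      have h := hfW x x' hxx y
      rw [hf1, hf0 (x', y) (Or.inr rfl)] at h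
      exact one_ne_zero h
    ext ⟨a, b⟩
    simp only [Set.mem_univ, iff_true]
    have hcl : IsClosed {a : X | (a, b) ∈ Z} := hZclosed.preimage (by fun_prop)
    have hsub : {x' : X | ∃ s : G, x' = s • x} ⊆ {a : X | (a, b) ∈ Z} := by
      rintro _ ⟨s, rfl⟩
      have := hZinv s (x, s⁻¹ • b) (hxZ _)
      simpa using this
    exact hcl.closure_subset_iff.2 hsub (hminX x a)
  have huniq : ∀ x x' y, (x, y) ∈ Z → (x', y) ∈ Z → x = x' := by
    intro x x' y h h'
    by_contra hne
    obtain ⟨f, hf0, hf1⟩ := ury {(x', y)} (x, y) isClosed_singleton (by simp [hne])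
    have hfW : f ∈ {f : C(X × Y, ℂ) | ∀ x x' : X, r x x' → ∀ y : Y, f (x, y) = f (x', y)} := by
      intro a a' ha b
      rw [hreq a a' ha]
    rw [← hW] at hfW
    obtain ⟨g, k, hk, rfl⟩ := hfW
    have e0 := hf0 (x', y) rfl
    simp [hk _ h'] at e0
    simp [hk _ h, e0] at hf1
  have hex : ∀ y : Y, ∃ x, (x, y) ∈ Z := by
    obtain ⟨⟨x0, y0⟩, h0⟩ := hZne
    have hcl : IsClosed (Prod.snd '' Z) := (hZclosed.isCompact.image continuous_snd).isClosed
    have hsub : {y' : Y | ∃ s : G, y' = s • y0} ⊆ Prod.snd '' Z := by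
      rintro _ ⟨s, rfl⟩
      exact ⟨_, hZinv s _ h0, rfl⟩
    intro y
    obtain ⟨⟨x, y'⟩, h, rfl⟩ := hcl.closure_subset_iff.2 hsub (hminY y0 y)
    exact ⟨x, h⟩
  choose φ hφ using hex
  have hφc : Continuous φ := by
    rw [continuous_iff_isClosed]
    intro C hC
    have he : φ ⁻¹' C = Prod.snd '' (Z ∩ Prod.fst ⁻¹' C) := by
      ext y
      constructor
      · intro h
        exact ⟨(φ y, y), ⟨hφ y, h⟩, rfl⟩
      · rintro ⟨⟨x, y'⟩, ⟨h, hx⟩, rfl⟩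
        have hx' : x ∈ C := hx
        rw [huniq _ _ _ h (hφ y')] at hx'
        exact hx'
    rw [he]
    exact ((hZclosed.inter (hC.preimage continuous_fst)).isCompact.image continuous_snd).isClosed
  refine ⟨fun x x' => ⟨hreq x x', fun h => h ▸ hr.refl x⟩, φ, hφc, ?_, ?_⟩
  · obtain ⟨⟨x0, y0⟩, h0⟩ := hZne
    have hcl : IsClosed (Set.range φ) := by
      have : CompactSpace Y := inferInstance
      exact (isCompact_range hφc).isClosed
    have hsub : {x' : X | ∃ s : G, x' = s • φ y0} ⊆ Set.range φ := by
      rintro _ ⟨s, rfl⟩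
      exact ⟨s • y0, huniq _ _ _ (hφ _) (hZinv s _ (hφ y0))⟩
    intro x
    exact hcl.closure_subset_iff.2 hsub (hminX (φ y0) x)
  · ext ⟨x, y⟩
    constructor
    · intro h
      exact ⟨y, by rw [huniq _ _ _ h (hφ y)]⟩
    · rintro ⟨y', h⟩
      rw [h]
      exact hφ y'
end

section
/- Let G be a discrete group acting continuously on a compact Hausdorff space X with C(X) G-simple (equivalently, G ↷ X minimal), and let B be a G-simple unital C*-algebra with a G-action by *-automorphisms such that B is noncommutative and both C(X) and B admit faithful states. Assume that C(X,B), with the diagonal G-action, is not G-simple. Then there exists a G-invariant closed *-subalgebra 𝓒 with C(X) ⊊ 𝓒 ⊆ C(X,B) that does not split: there is no G-invariant closed *-subalgebra 𝓑̃ ⊆ B with 𝓒 = {f ∈ C(X,B) : f(x) ∈ 𝓑̃ for all x ∈ X}. -/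
open scoped ComplexOrder

/-- Fiberwise non-units: elements of a proper invariant ideal are nowhere invertible. -/
theorem aux_not_isUnit
    {G X B : Type*} [Group G] [TopologicalSpace X] [CompactSpace X]
    [MulAction G X] (hc : ∀ s : G, Continuous fun x : X => s • x)
    (hmin : ∀ x : X, Dense {y : X | ∃ s : G, y = s • x})
    [CStarAlgebra B] (σ : G →* (B →⋆ₐ[ℂ] B)) (I : Set C(X, B))
    (h0 : (0 : C(X, B)) ∈ I)
    (hadd : ∀ f ∈ I, ∀ g ∈ I, f + g ∈ I)
    (hmul : ∀ f ∈ I, ∀ g : C(X, B), f * g ∈ I ∧ g * f ∈ I)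
    (hinv : ∀ s : G, ∀ f ∈ I, diagAct hc σ s f ∈ I)
    (hI : I ≠ Set.univ) (f : C(X, B)) (hf : f ∈ I) (x : X) : ¬ IsUnit (f x) := by
  intro hu
  apply hI
  let _ : PartialOrder B := CStarAlgebra.spectralOrder B
  have _ : StarOrderedRing B := CStarAlgebra.spectralOrderedRing B
  have hopen : ∀ f : C(X, B), IsOpen {z : X | IsUnit (f z)} := fun f =>
    Units.isOpen.preimage f.continuous
  have hloc : ∀ y : X, ∃ h ∈ I, IsUnit (h y) := by
    intro y
    obtain ⟨z, ⟨s, rfl⟩, hz⟩ := (hmin y).exists_mem_open (hopen f) ⟨x, hu⟩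
    refine ⟨_, hinv s⁻¹ f hf, ?_⟩
    have h2 : IsUnit (f (s • y)) := hz
    have := h2.map (σ s⁻¹)
    simpa [diagAct] using this
  have key : ∃ h ∈ I, (∀ y, 0 ≤ h y) ∧ ∀ y ∈ (Set.univ : Set X), IsUnit (h y) := by
    refine isCompact_univ.induction_on
      (p := fun S => ∃ h ∈ I, (∀ y, 0 ≤ h y) ∧ ∀ y ∈ S, IsUnit (h y)) ?_ ?_ ?_ ?_
    · exact ⟨0, h0, fun y => le_rfl, by simp⟩
    · rintro s t hst ⟨h, h1, h2, h3⟩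
      exact ⟨h, h1, h2, fun y hy => h3 y (hst hy)⟩
    · rintro s t ⟨h, h1, h2, h3⟩ ⟨k, k1, k2, k3⟩
      refine ⟨h + k, hadd _ h1 _ k1, fun y => add_nonneg (h2 y) (k2 y), ?_⟩
      rintro y (hy | hy)
      · exact CStarAlgebra.isUnit_of_le (h y) (le_add_of_nonneg_right (k2 y))
          ⟨h2 y, h3 y hy⟩
      · exact CStarAlgebra.isUnit_of_le (k y) (le_add_of_nonneg_left (h2 y))
          ⟨k2 y, k3 y hy⟩
    · intro y _
      obtain ⟨h, h1, h2⟩ := hloc y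
      refine ⟨{z | IsUnit (h z)}, mem_nhdsWithin_of_mem_nhds ((hopen h).mem_nhds h2),
        star h * h, (hmul h h1 _).2, fun z => star_mul_self_nonneg (h z), ?_⟩
      intro z hz
      have hz' : IsUnit (h z) := hz
      exact hz'.star.mul hz'
  obtain ⟨h, h1, -, h3⟩ := key
  have hunit : IsUnit h := (ContinuousMap.isUnit_iff_forall_isUnit h).2 fun y => h3 y trivial
  obtain ⟨u, rfl⟩ := hunit
  ext k
  simp only [Set.mem_univ, iff_true]
  simpa using (hmul _ h1 ((↑u⁻¹ : C(X, B)) * k)).1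

theorem aux_diagAct_continuous
    {G X B : Type*} [Group G] [TopologicalSpace X] 
    [MulAction G X] (hc : ∀ s : G, Continuous fun x : X => s • x)
    [CStarAlgebra B] (σ : G →* (B →⋆ₐ[ℂ] B)) (s : G) : Continuous (diagAct hc σ s) :=
  (ContinuousMap.continuous_postcomp ⟨σ s, MonoidHom.starAlgHom_continuous σ s⟩).comp
    (ContinuousMap.continuous_precomp ⟨fun x => s⁻¹ • x, hc s⁻¹⟩)

/-- The star subalgebra `C(X) + K` for a self-adjoint ideal `K`. -/
noncomputable def auxAlg {X B : Type*} [TopologicalSpace X] [CompactSpace X] [CStarAlgebra B]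
    (K : Submodule ℂ C(X, B)) (hmul : ∀ f ∈ K, ∀ g : C(X, B), f * g ∈ K ∧ g * f ∈ K)
    (hstar : ∀ f ∈ K, star f ∈ K) : StarSubalgebra ℂ C(X, B) where
  carrier := {f | ∃ g : C(X, ℂ), f - embedScalar B g ∈ K}
  mul_mem' := by
    rintro a b ⟨g, hg⟩ ⟨h, hh⟩
    refine ⟨g * h, ?_⟩
    have e : a * b - embedScalar B (g * h)
        = (a - embedScalar B g) * b + embedScalar B g * (b - embedScalar B h) := by
      ext x
      simp [embedScalar, sub_mul, mul_sub, smul_smul, mul_comm]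
    rw [e]
    exact K.add_mem (hmul _ hg _).1 (hmul _ hh _).2
  add_mem' := by
    rintro a b ⟨g, hg⟩ ⟨h, hh⟩
    refine ⟨g + h, ?_⟩
    have e : a + b - embedScalar B (g + h)
        = (a - embedScalar B g) + (b - embedScalar B h) := by
      ext x
      simp [embedScalar, add_smul]
      abel
    rw [e]
    exact K.add_mem hg hh
  algebraMap_mem' := by
    intro c
    refine ⟨ContinuousMap.const X c, ?_⟩
    have e : algebraMap ℂ C(X, B) c - embedScalar B (ContinuousMap.const X c) = 0 := by
      ext x
      simp [embedScalar, Algebra.algebraMap_eq_smul_one]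
    rw [e]
    exact K.zero_mem
  star_mem' := by
    rintro a ⟨g, hg⟩
    refine ⟨star g, ?_⟩
    have e : star a - embedScalar B (star g) = star (a - embedScalar B g) := by
      ext x
      simp [embedScalar]
    rw [e]
    exact hstar _ hg

/-- The main construction, for a self-adjoint ideal. -/
theorem aux_main
    {G X B : Type*} [Group G] [TopologicalSpace X] [CompactSpace X]
    [MulAction G X] (hc : ∀ s : G, Continuous fun x : X => s • x)
    [CStarAlgebra B] (σ : G →* (B →⋆ₐ[ℂ] B))
    (hBsimple : ∀ I : Set B, IsClosed I → (0 : B) ∈ I →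
      (∀ a ∈ I, ∀ b ∈ I, a + b ∈ I) → (∀ a ∈ I, ∀ b : B, a * b ∈ I ∧ b * a ∈ I) →
      (∀ g : G, ∀ a ∈ I, σ g a ∈ I) → I = {0} ∨ I = Set.univ)
    (hBnoncomm : ∃ a b : B, a * b ≠ b * a)
    (K : Submodule ℂ C(X, B)) (hmul : ∀ f ∈ K, ∀ g : C(X, B), f * g ∈ K ∧ g * f ∈ K)
    (hstar : ∀ f ∈ K, star f ∈ K)
    (hinv : ∀ s : G, ∀ f ∈ K, diagAct hc σ s f ∈ K)
    (hnu : ∀ f ∈ K, ∀ x, ¬ IsUnit (f x)) (f₀ : C(X, B)) (hf₀ : f₀ ∈ K)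
    (x₀ : X) (hx₀ : f₀ x₀ ≠ 0) :
    ∃ 𝓒 : StarSubalgebra ℂ C(X, B), IsClosed (𝓒 : Set C(X, B)) ∧
      (∀ s : G, ∀ f ∈ 𝓒, diagAct hc σ s f ∈ 𝓒) ∧
      (∀ g : C(X, ℂ), embedScalar B g ∈ 𝓒) ∧
      (∃ f ∈ 𝓒, ∀ g : C(X, ℂ), f ≠ embedScalar B g) ∧
      ¬ ∃ 𝓑t : StarSubalgebra ℂ B, IsClosed (𝓑t : Set B) ∧
        (∀ s : G, ∀ b ∈ 𝓑t, σ s b ∈ 𝓑t) ∧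
        (𝓒 : Set C(X, B)) = {f : C(X, B) | ∀ x : X, f x ∈ 𝓑t} := by
  set S := auxAlg K hmul hstar with hS
  have hKS : ∀ f ∈ K, f ∈ S := by
    intro f hf
    refine ⟨0, ?_⟩
    have e : f - embedScalar B 0 = f := by ext x; simp [embedScalar]
    rw [e]; exact hf
  have hgS : ∀ g, embedScalar B g ∈ S := fun g => ⟨g, by rw [sub_self]; exact K.zero_mem⟩
  have hSinv : ∀ s : G, ∀ f ∈ S, diagAct hc σ s f ∈ S := by
    rintro s f ⟨g, hg⟩
    refine ⟨g.comp ⟨fun x => s⁻¹ • x, hc s⁻¹⟩, ?_⟩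
    have := hinv s _ hg
    convert this using 1
    ext x
    simp [diagAct, embedScalar]
  refine ⟨S.topologicalClosure, S.isClosed_topologicalClosure, ?_, ?_, ?_, ?_⟩
  · intro s f hf
    exact map_mem_closure (aux_diagAct_continuous hc σ s) hf (fun a ha => hSinv s a ha)
  · intro g
    exact S.le_topologicalClosure (hgS g)
  · refine ⟨f₀, S.le_topologicalClosure (hKS _ hf₀), ?_⟩
    rintro g rfl
    apply hnu _ hf₀ x₀
    have hg : g x₀ ≠ 0 := by
      intro h
      apply hx₀
      simp [embedScalar, h]
    have : embedScalar B g x₀ = algebraMap ℂ B (g x₀) := by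
      simp [embedScalar, Algebra.algebraMap_eq_smul_one]
    rw [this]
    exact (IsUnit.mk0 _ hg).map _
  rintro ⟨T, hTc, hTinv, hT⟩
  let ev : X → C(X, B) →ₗ[ℂ] B := fun x =>
    { toFun := fun f => f x, map_add' := fun _ _ => rfl, map_smul' := fun _ _ => rfl }
  let J : X → Submodule ℂ B := fun x => (K.map (ev x)).topologicalClosure
  have hJc : ∀ x, IsClosed (J x : Set B) := fun x => Submodule.isClosed_topologicalClosure _
  have hKJ : ∀ x, ∀ f ∈ K, f x ∈ J x := fun x f hf =>
    Submodule.le_topologicalClosure _ ⟨f, hf, rfl⟩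
  have hJind : ∀ x (F : B → B), Continuous F → ∀ A : Set B, IsClosed A →
      (∀ f ∈ K, F (f x) ∈ A) → ∀ a ∈ J x, F a ∈ A := by
    intro x F hF A hA h a ha
    have ha' : a ∈ closure ((K.map (ev x) : Submodule ℂ B) : Set B) := ha
    have := map_mem_closure hF ha' (t := A) (by rintro _ ⟨f, hf, rfl⟩; exact h f hf)
    rwa [hA.closure_eq] at this
  have hJl : ∀ x, ∀ a ∈ J x, ∀ b, b * a ∈ J x := by
    intro x a ha b
    refine hJind x (fun a => b * a) (continuous_const.mul continuous_id) _ (hJc x) ?_ a ha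
    intro f hf
    exact hKJ x _ (hmul f hf (ContinuousMap.const X b)).2
  have hJr : ∀ x, ∀ a ∈ J x, ∀ b, a * b ∈ J x := by
    intro x a ha b
    refine hJind x (fun a => a * b) (continuous_id.mul continuous_const) _ (hJc x) ?_ a ha
    intro f hf
    exact hKJ x _ (hmul f hf (ContinuousMap.const X b)).1
  have hJ1 : ∀ x, (1 : B) ∉ J x := by
    intro x h
    exact hJind x id continuous_id _ (Units.isOpen (R := B)).isClosed_compl
      (fun f hf => hnu f hf x) 1 h isUnit_one
  have hJT : ∀ x, ∀ a ∈ J x, a ∈ T := by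
    intro x a ha
    refine hJind x id continuous_id _ hTc ?_ a ha
    intro f hf
    have : f ∈ (S.topologicalClosure : Set C(X, B)) := S.le_topologicalClosure (hKS f hf)
    rw [hT] at this
    exact this x
  have hJinv : ∀ s x, ∀ a ∈ J x, σ s a ∈ J (s • x) := by
    intro s x a ha
    refine hJind x (σ s) (MonoidHom.starAlgHom_continuous σ s) _ (hJc _) ?_ a ha
    intro f hf
    have := hKJ (s • x) _ (hinv s f hf)
    simpa [diagAct] using this
  have hTJ : ∀ b ∈ T, ∀ x, ∃ c : ℂ, b - c • (1 : B) ∈ J x := by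
    intro b hb x
    have hmem : ContinuousMap.const X b ∈ (S.topologicalClosure : Set C(X, B)) := by
      rw [hT]; exact fun _ => hb
    have hcl : IsClosed ((J x ⊔ Submodule.span ℂ {(1 : B)} : Submodule ℂ B) : Set B) :=
      Submodule.isClosed_sup_finiteDimensional _ _ (hJc x)
    have h2 : b ∈ closure ((J x ⊔ Submodule.span ℂ {(1 : B)} : Submodule ℂ B) : Set B) := by
      have hmem' : ContinuousMap.const X b ∈ closure (S : Set C(X, B)) := hmem
      refine map_mem_closure (f := fun f : C(X, B) => f x)
        (continuous_eval_const x) hmem' ?_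
      rintro f ⟨g, hg⟩
      have h3 := hKJ x _ hg
      refine Submodule.mem_sup.2 ⟨_, h3, g x • (1 : B),
        Submodule.smul_mem _ _ (Submodule.mem_span_singleton_self _), ?_⟩
      simp [embedScalar]
    rw [hcl.closure_eq] at h2
    obtain ⟨y, hy, z, hz, rfl⟩ := Submodule.mem_sup.1 h2
    obtain ⟨c, rfl⟩ := Submodule.mem_span_singleton.1 hz
    exact ⟨c, by simpa using hy⟩
  have hint : ∀ a, (∀ x, a ∈ J x) → a = 0 := by
    have hB := hBsimple {a | ∀ x, a ∈ J x}
      (by rw [Set.setOf_forall]; exact isClosed_iInter hJc)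
      (fun x => (J x).zero_mem)
      (fun a ha b hb x => (J x).add_mem (ha x) (hb x))
      (fun a ha b => ⟨fun x => hJr x a (ha x) b, fun x => hJl x a (ha x) b⟩)
      (by
        intro s a ha x
        have := hJinv s (s⁻¹ • x) a (ha _)
        rwa [smul_inv_smul] at this)
    rcases hB with h | h
    · intro a ha
      have : a ∈ {a | ∀ x, a ∈ J x} := ha
      rw [h] at this
      exact this
    · have : (1 : B) ∈ {a | ∀ x, a ∈ J x} := by rw [h]; trivial
      exact absurd (this x₀) (hJ1 x₀)
  by_cases hall : ∀ x y, ∀ a ∈ J x, a ∈ J y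
  · exact hx₀ (hint _ fun y => hall x₀ y _ (hKJ x₀ f₀ hf₀))
  push Not at hall
  obtain ⟨x, y, a, hax, hay⟩ := hall
  obtain ⟨c, hcj⟩ := hTJ a (hJT x a hax) y
  have hc0 : c ≠ 0 := by
    rintro rfl
    apply hay
    simpa using hcj
  have hTtop : ∀ b, b ∈ T := by
    intro b
    have h1 : a * b ∈ T := hJT x _ (hJr x a hax b)
    have h2 : (a - c • (1 : B)) * b ∈ T := hJT y _ (hJr y _ hcj b)
    have h3 : c⁻¹ • (a * b - (a - c • (1 : B)) * b) = b := by
      rw [← sub_mul, sub_sub_cancel, smul_mul_assoc, one_mul, smul_smul, inv_mul_cancel₀ hc0,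
        one_smul]
    rw [← h3]
    exact T.smul_mem (sub_mem h1 h2) _
  obtain ⟨p, q, hpq⟩ := hBnoncomm
  apply hpq
  rw [← sub_eq_zero]
  apply hint
  intro z
  obtain ⟨α, hα⟩ := hTJ p (hTtop p) z
  have e : p * q - q * p = (p - α • (1 : B)) * q - q * (p - α • (1 : B)) := by
    simp [sub_mul, mul_sub]
  rw [e]
  exact (J z).sub_mem (hJr z _ hα q) (hJl z _ hα q)

/- STATEMENT 13: If `G ↷ X` is minimal (`C(X)` is `G`-simple), `B` is `G`-simple,
noncommutative, both `C(X)` and `B` admit faithful states, and `C(X,B)` is *not*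
`G`-simple, then there exists a `G`-invariant closed intermediate *-subalgebra
`C(X) ⊊ 𝓒 ⊆ C(X,B)` which does not split as `C(X) ⊗min 𝓑̃`. -/
theorem exists_nonsplitting_intermediate_algebra
    {G X B : Type*} [Group G] [TopologicalSpace X] [CompactSpace X] [T2Space X]
    [MulAction G X] (hc : ∀ s : G, Continuous fun x : X => s • x)
    (hmin : ∀ x : X, Dense {y : X | ∃ s : G, y = s • x})
    [CStarAlgebra B] (σ : G →* (B →⋆ₐ[ℂ] B))
    (hBsimple : ∀ I : Set B, IsClosed I → (0 : B) ∈ I →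
      (∀ a ∈ I, ∀ b ∈ I, a + b ∈ I) → (∀ a ∈ I, ∀ b : B, a * b ∈ I ∧ b * a ∈ I) →
      (∀ g : G, ∀ a ∈ I, σ g a ∈ I) → I = {0} ∨ I = Set.univ)
    (hBnoncomm : ∃ a b : B, a * b ≠ b * a)
    (hfaithX : ∃ φ : C(X, ℂ) →L[ℂ] ℂ, φ 1 = 1 ∧ (∀ f : C(X, ℂ), 0 ≤ φ (star f * f)) ∧
      ∀ f : C(X, ℂ), φ (star f * f) = 0 → f = 0)
    (hfaithB : ∃ ψ : B →L[ℂ] ℂ, ψ 1 = 1 ∧ (∀ b : B, 0 ≤ ψ (star b * b)) ∧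
      ∀ b : B, ψ (star b * b) = 0 → b = 0)
    (hnotGsimple : ∃ I : Set C(X, B), IsClosed I ∧ (0 : C(X, B)) ∈ I ∧
      (∀ f ∈ I, ∀ g ∈ I, f + g ∈ I) ∧
      (∀ f ∈ I, ∀ g : C(X, B), f * g ∈ I ∧ g * f ∈ I) ∧
      (∀ s : G, ∀ f ∈ I, diagAct hc σ s f ∈ I) ∧
      I ≠ {0} ∧ I ≠ Set.univ) :
    ∃ 𝓒 : StarSubalgebra ℂ C(X, B), IsClosed (𝓒 : Set C(X, B)) ∧
      (∀ s : G, ∀ f ∈ 𝓒, diagAct hc σ s f ∈ 𝓒) ∧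
      (∀ g : C(X, ℂ), embedScalar B g ∈ 𝓒) ∧
      (∃ f ∈ 𝓒, ∀ g : C(X, ℂ), f ≠ embedScalar B g) ∧
      ¬ ∃ 𝓑t : StarSubalgebra ℂ B, IsClosed (𝓑t : Set B) ∧
        (∀ s : G, ∀ b ∈ 𝓑t, σ s b ∈ 𝓑t) ∧
        (𝓒 : Set C(X, B)) = {f : C(X, B) | ∀ x : X, f x ∈ 𝓑t} := by
  obtain ⟨I, hIc, h0, hadd, hmul, hinv, hne, hnu⟩ := hnotGsimple
  have hsmul : ∀ c : ℂ, ∀ f ∈ I, c • f ∈ I := by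
    intro c f hf
    have := (hmul f hf (c • 1)).2
    rwa [smul_mul_assoc, one_mul] at this
  have hdstar : ∀ s f, diagAct hc σ s (star f) = star (diagAct hc σ s f) := by
    intro s f
    ext x
    exact map_star (σ s) (f (s⁻¹ • x))
  let K : Submodule ℂ C(X, B) :=
    { carrier := {f | f ∈ I ∧ star f ∈ I}
      zero_mem' := ⟨h0, by rw [star_zero]; exact h0⟩
      add_mem' := by
        rintro f g ⟨h1, h2⟩ ⟨h3, h4⟩
        exact ⟨hadd _ h1 _ h3, by rw [star_add]; exact hadd _ h2 _ h4⟩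
      smul_mem' := by
        rintro c f ⟨h1, h2⟩
        exact ⟨hsmul c f h1, by rw [star_smul]; exact hsmul _ _ h2⟩ }
  obtain ⟨f, hf, hf0⟩ : ∃ f ∈ I, f ≠ 0 := by
    by_contra! h
    exact hne (Set.eq_singleton_iff_unique_mem.2 ⟨h0, h⟩)
  obtain ⟨x₀, hx₀⟩ : ∃ x, f x ≠ 0 := by
    by_contra! h
    exact hf0 (ContinuousMap.ext h)
  refine aux_main hc σ hBsimple hBnoncomm K ?_ ?_ ?_ ?_ (star f * f) ?_ x₀ ?_
  · rintro f ⟨h1, h2⟩ g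
    refine ⟨⟨(hmul f h1 g).1, ?_⟩, ⟨(hmul f h1 g).2, ?_⟩⟩
    · rw [star_mul]; exact (hmul _ h2 _).2
    · rw [star_mul]; exact (hmul _ h2 _).1
  · rintro f ⟨h1, h2⟩
    exact ⟨h2, by rw [star_star]; exact h1⟩
  · rintro s f ⟨h1, h2⟩
    exact ⟨hinv s f h1, by rw [← hdstar]; exact hinv s _ h2⟩
  · rintro f ⟨h1, -⟩ x
    exact aux_not_isUnit hc hmin σ I h0 hadd hmul hinv hnu f h1 x
  · have h1 := (hmul f hf (star f)).2
    refine ⟨h1, ?_⟩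
    rw [star_mul, star_star]; exact h1
  · exact fun h => hx₀ ((CStarRing.star_mul_self_eq_zero_iff _).1 h)
end

section
/- Let G be a discrete group acting continuously on a compact Hausdorff space X. Then the induced action of G on C(X) (given by (s·f)(x) = f(s⁻¹·x)) is uniformly rigid if and only if the action G ↷ X is uniformly rigid. -/
open Filter Topology

/- STATEMENT 14: The induced action of `G` on `C(X)` is uniformly rigid iff the action
`G ↷ X` is uniformly rigid.  (A net of non-identity elements of `G` is encoded by a
nontrivial filter `l` on `G` containing the set of non-identity elements; on the
algebra side uniform rigidity means `‖s • f − f‖ → 0` along `l` for every `f ∈ C(X)`,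
and on the space side it means uniform convergence of `x ↦ s • x` to the identity,
expressed via the canonical uniformity of the compact Hausdorff space `X`, whose
entourages are the neighborhoods of the diagonal.) -/
theorem uniformlyRigid_CX_iff_uniformlyRigid_space
    {G X : Type*} [Group G] [TopologicalSpace X] [CompactSpace X] [T2Space X]
    [MulAction G X] (hc : ∀ s : G, Continuous fun x : X => s • x) :
    (∃ l : Filter G, l.NeBot ∧ {s : G | s ≠ 1} ∈ l ∧
        ∀ f : C(X, ℂ), Filter.Tendsto
          (fun s : G => ‖f.comp ⟨fun x : X => s⁻¹ • x, hc s⁻¹⟩ - f‖) l (𝓝 0)) ↔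
      (∃ l : Filter G, l.NeBot ∧ {s : G | s ≠ 1} ∈ l ∧
        ∀ U : Set (X × X), IsOpen U → Set.diagonal X ⊆ U →
          ∀ᶠ s : G in l, ∀ x : X, (s • x, x) ∈ U) := by
  have key : ∀ (l : Filter G), (∀ f : C(X, ℂ), Filter.Tendsto
          (fun s : G => ‖f.comp ⟨fun x : X => s⁻¹ • x, hc s⁻¹⟩ - f‖) l (𝓝 0)) ↔
        (∀ U : Set (X × X), IsOpen U → Set.diagonal X ⊆ U →
          ∀ᶠ s : G in l, ∀ x : X, (s • x, x) ∈ U) := by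
    intro l
    constructor
    · intro h U hU hdiag
      have hK : IsCompact Uᶜ := hU.isClosed_compl.isCompact
      have main : ∀ᶠ s : G in l, ∀ x : X, (s • x, x) ∉ Uᶜ := by
        refine hK.induction_on (p := fun S => ∀ᶠ s : G in l, ∀ x : X, (s • x, x) ∉ S)
          ?_ ?_ ?_ ?_
        · exact Filter.Eventually.of_forall fun s x hx => hx
        · intro S T hST hT
          filter_upwards [hT] with s hs x hx using hs x (hST hx)
        · intro S T hS hT
          filter_upwards [hS, hT] with s h1 h2 x hx
          exact hx.elim (h1 x) (h2 x)
        · rintro ⟨a, b⟩ hab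
          have hne : a ≠ b := fun e => hab (hdiag e)
          obtain ⟨g, hg0, hg1, -⟩ := exists_continuous_zero_one_of_isClosed
            (isClosed_singleton (x := a)) (isClosed_singleton (x := b)) (by simpa using hne)
          let f : C(X, ℂ) := ⟨fun x => (g x : ℂ), Complex.continuous_ofReal.comp g.continuous⟩
          have hfa : f a = 0 := by
            have : g a = 0 := hg0 rfl
            simp [f, this]
          have hfb : f b = 1 := by
            have : g b = 1 := hg1 rfl
            simp [f, this]
          refine ⟨{p | 1 / 2 < dist (f p.1) (f p.2)}, ?_, ?_⟩
          · apply mem_nhdsWithin_of_mem_nhds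
            apply IsOpen.mem_nhds
            · exact isOpen_lt continuous_const (by fun_prop)
            · simp only [Set.mem_ofPred_eq, hfa, hfb]
              norm_num
          · filter_upwards [(h f).eventually (gt_mem_nhds (show (0 : ℝ) < 1 / 2 by norm_num))]
              with s hs x hx
            have := (ContinuousMap.norm_coe_le_norm
              (f.comp ⟨fun x : X => s⁻¹ • x, hc s⁻¹⟩ - f) (s • x))
            simp only [ContinuousMap.sub_apply, ContinuousMap.comp_apply, ContinuousMap.coe_mk,
              inv_smul_smul] at this
            rw [← dist_eq_norm, dist_comm] at this
            have hx2 : 1 / 2 < dist (f (s • x)) (f x) := hx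
            linarith
      filter_upwards [main] with s hs x
      exact not_not.mp (hs x)
    · intro h f
      rw [Metric.tendsto_nhds]
      intro ε hε
      filter_upwards [h {p | dist (f p.1) (f p.2) < ε}
        (isOpen_lt (by fun_prop) continuous_const) (by
          rintro ⟨a, b⟩ hab
          have : a = b := hab
          subst this
          simpa using hε)] with s hs
      rw [Real.dist_eq, sub_zero, abs_of_nonneg (norm_nonneg _),
        ContinuousMap.norm_lt_iff _ hε]
      intro y
      have := hs (s⁻¹ • y)
      simp only [smul_inv_smul] at this
      rw [dist_comm, dist_eq_norm] at this
      simpa using this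
  simp only [key]
end

section
/- Let G be an infinite discrete group acting by *-automorphisms on a finite-dimensional unital C*-algebra A. Then this action is uniformly rigid: there is a net (s_i) of non-identity elements of G with lim_i ‖s_i·a − a‖ = 0 for every a ∈ A. -/
open Filter Topology

/- STATEMENT 16: Every action of an infinite discrete group `G` by *-automorphisms on
a finite-dimensional unital C*-algebra `A` is uniformly rigid: there is a net (encoded
as a nontrivial filter `l` on `G` containing the non-identity elements) along which
`‖s • a − a‖ → 0` for every `a ∈ A`. -/
theorem uniformlyRigid_of_action_on_finiteDimensional
    {G A : Type*} [Group G] [Infinite G] [CStarAlgebra A] [FiniteDimensional ℂ A]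
    (β : G →* (A →⋆ₐ[ℂ] A)) :
    ∃ l : Filter G, l.NeBot ∧ {s : G | s ≠ 1} ∈ l ∧
      ∀ a : A, Filter.Tendsto (fun s : G => ‖β s a - a‖) l (𝓝 0) := by
  classical
  let U : Ultrafilter G := hyperfilter G
  have hlim : ∀ a : A, ∃ b : A, Tendsto (fun s : G => β s a) U (𝓝 b) := by
    intro a
    have : ProperSpace A := FiniteDimensional.proper ℂ A
    have hc : IsCompact (Metric.closedBall (0 : A) ‖a‖) := isCompact_closedBall _ _
    obtain ⟨b, -, hb⟩ := hc.ultrafilter_le_nhds (U.map fun s : G => β s a) (by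
      rw [le_principal_iff]
      refine Filter.mem_map.2 (Filter.mem_of_superset Filter.univ_mem fun s _ => ?_)
      simpa using NonUnitalStarAlgHom.norm_apply_le (β s) a)
    exact ⟨b, hb⟩
  have hne : ((U : Filter G) ×ˢ (U : Filter G) ⊓ 𝓟 {p : G × G | p.1 ≠ p.2}).NeBot := by
    rw [Filter.inf_principal_neBot_iff]
    intro W hW
    obtain ⟨V, hV, hVW⟩ := Filter.mem_prod_same_iff.1 hW
    have hinf : V.Infinite := fun hf => notMem_hyperfilter_of_finite hf hV
    obtain ⟨x, hx, y, hy, hxy⟩ := hinf.nontrivial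
    exact ⟨(x, y), hVW ⟨hx, hy⟩, hxy⟩
  refine ⟨Filter.map (fun p : G × G => p.1⁻¹ * p.2)
    ((U : Filter G) ×ˢ (U : Filter G) ⊓ 𝓟 {p : G × G | p.1 ≠ p.2}), hne.map _, ?_, ?_⟩
  · rw [Filter.mem_map]
    refine Filter.mem_of_superset (Filter.mem_inf_of_right (Filter.mem_principal_self _)) ?_
    intro p hp h
    exact hp (inv_mul_eq_one.1 h)
  · intro a
    rw [Filter.tendsto_map'_iff]
    refine Filter.Tendsto.mono_left ?_ inf_le_left
    obtain ⟨b, hb⟩ := hlim a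
    have h1 : Tendsto (fun p : G × G => ‖β p.2 a - β p.1 a‖)
        ((U : Filter G) ×ˢ (U : Filter G)) (𝓝 0) := by
      simpa using ((hb.comp tendsto_snd).sub (hb.comp tendsto_fst)).norm
    refine squeeze_zero (fun _ => norm_nonneg _) (fun p => ?_) h1
    have h2 : β (p.1⁻¹ * p.2) a - a = β p.1⁻¹ (β p.2 a - β p.1 a) := by
      have h3 : β p.1⁻¹ (β p.1 a) = a := by
        change (β p.1⁻¹ * β p.1) a = a
        rw [← map_mul, inv_mul_cancel, map_one]
        rfl
      rw [map_sub, h3, map_mul]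
      rfl
    simp only [Function.comp_apply]
    rw [h2]
    exact NonUnitalStarAlgHom.norm_apply_le _ _
end
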